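/- arXiv:2109.12610 — 3 statements merged into one kernel-verified Lean document; each statement's English description precedes it below -/
import Mathlib

section
/- Let s ∈ (0,1) and let n be an integer with n > 2s. Given a point x̄ ∈ ℝⁿ and two radii 0 < r < R, there exists a Lipschitz function φ : ℝⁿ → [0,1] such that: (1) φ ≡ 1 on the ball B(x̄, r); (2) φ ≡ 0 outside B(x̄, R); (3) ∫_{ℝⁿ} |(−Δ)^{s/2}φ|^{n/s} ≤ C(n,s) (log(R/r))^{1−n/s} for a constant C(n,s) depending only on n and s. -/
open MeasureTheory

noncomputable section

abbrev Euc (n : ℕ) := EuclideanSpace ℝ (Fin n)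

/-- Normalization constant of the fractional Laplacian `(-Δ)^s` on `ℝⁿ`. -/
noncomputable def fracC (n : ℕ) (s : ℝ) : ℝ :=
  2 ^ (2 * s) * Real.Gamma (((n : ℝ) + 2 * s) / 2) /
    (Real.pi ^ ((n : ℝ) / 2) * |Real.Gamma (-s)|)

/-- The fractional Laplacian `(-Δ)^s u` of order `s`, as a symmetrized singular integral. -/
noncomputable def fracLap (n : ℕ) (s : ℝ) (u : Euc n → ℝ) (x : Euc n) : ℝ :=
  (fracC n s / 2) *
    ∫ y : Euc n, (2 * u x - u (x + y) - u (x - y)) / ‖y‖ ^ ((n : ℝ) + 2 * s)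

/-- The homogeneous `Ḣˢ` inner product (Gagliardo form). -/
noncomputable def hsInner (n : ℕ) (s : ℝ) (u v : Euc n → ℝ) : ℝ :=
  (fracC n s / 2) *
    ∫ x : Euc n, ∫ y : Euc n,
      (u x - u y) * (v x - v y) / ‖x - y‖ ^ ((n : ℝ) + 2 * s)

noncomputable def hsNormSq (n : ℕ) (s : ℝ) (u : Euc n → ℝ) : ℝ := hsInner n s u u

noncomputable def hsNorm (n : ℕ) (s : ℝ) (u : Euc n → ℝ) : ℝ := Real.sqrt (hsNormSq n s u)

/-- Membership in the homogeneous Sobolev space `Ḣˢ(ℝⁿ)`. -/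
def MemHs (n : ℕ) (s : ℝ) (u : Euc n → ℝ) : Prop :=
  Measurable u ∧
    Integrable (fun q : Euc n × Euc n =>
      (u q.1 - u q.2) ^ 2 / ‖q.1 - q.2‖ ^ ((n : ℝ) + 2 * s))

/-- The `H^{-s}` (dual) norm of `f`. -/
noncomputable def negSobNorm (n : ℕ) (s : ℝ) (f : Euc n → ℝ) : ℝ :=
  sSup {r : ℝ | ∃ φ : Euc n → ℝ, MemHs n s φ ∧ hsNorm n s φ ≤ 1 ∧ r = ∫ x, f x * φ x}

/-- The critical exponent `p = 2^* - 1 = (n+2s)/(n-2s)`. -/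
noncomputable def pexp (n : ℕ) (s : ℝ) : ℝ := ((n : ℝ) + 2 * s) / ((n : ℝ) - 2 * s)

/-- A Talenti bubble `U[z,λ]`. -/
noncomputable def bubble (n : ℕ) (cns : ℝ) (s : ℝ) (z : Euc n) (lam : ℝ) (x : Euc n) : ℝ :=
  cns * (lam / (1 + lam ^ 2 * ‖x - z‖ ^ 2)) ^ (((n : ℝ) - 2 * s) / 2)

/-- `∂U[z,λ]/∂λ`. -/
noncomputable def dLamBubble (n : ℕ) (cns s : ℝ) (z : Euc n) (lam : ℝ) : Euc n → ℝ :=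
  fun x => deriv (fun l : ℝ => bubble n cns s z l x) lam

/-- `∂U[z,λ]/∂z_j`. -/
noncomputable def dZBubble (n : ℕ) (cns s : ℝ) (z : Euc n) (lam : ℝ) (j : Fin n) : Euc n → ℝ :=
  fun x => deriv (fun t : ℝ => bubble n cns s (z + t • EuclideanSpace.single j (1 : ℝ)) lam x) 0

/-- The rescaled derivatives `Z_i^a` (`a = 1,…,n` translations, `a = n+1` dilation). -/
noncomputable def Zb (n : ℕ) (cns s : ℝ) (z : Euc n) (lam : ℝ) (a : Fin (n + 1)) : Euc n → ℝ :=
  if h : (a : ℕ) < n then fun x => lam⁻¹ * dZBubble n cns s z lam ⟨a, h⟩ x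
  else fun x => lam * dLamBubble n cns s z lam x

/-- A `δ`-interacting family of bubbles. -/
def DeltaInteracting (n : ℕ) {ν : ℕ} (z : Fin ν → Euc n) (lam : Fin ν → ℝ) (δ : ℝ) : Prop :=
  (∀ i, 0 < lam i) ∧
    ∀ i j, i ≠ j →
      min (lam i / lam j)
        (min (lam j / lam i) (1 / (lam i * lam j * ‖z i - z j‖ ^ 2))) ≤ δ

/-- The pairwise interaction `q_{ij}`. -/
noncomputable def qij (n : ℕ) (s : ℝ) {ν : ℕ} (z : Fin ν → Euc n) (lam : Fin ν → ℝ)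
    (i j : Fin ν) : ℝ :=
  (lam i / lam j + lam j / lam i + lam i * lam j * ‖z i - z j‖ ^ 2) ^
    (-(((n : ℝ) - 2 * s) / 2))

/-- `Q = max_{i ≠ j} q_{ij}`. -/
noncomputable def Qmax (n : ℕ) (s : ℝ) {ν : ℕ} (z : Fin ν → Euc n) (lam : Fin ν → ℝ) : ℝ :=
  sSup {q : ℝ | ∃ i j, i ≠ j ∧ q = qij n s z lam i j}

noncomputable def Rij (n : ℕ) {ν : ℕ} (z : Fin ν → Euc n) (lam : Fin ν → ℝ) (i j : Fin ν) : ℝ :=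
  max (Real.sqrt (lam i / lam j))
    (max (Real.sqrt (lam j / lam i)) (Real.sqrt (lam i * lam j) * ‖z i - z j‖))

/-- `R = (1/2) min_{i≠j} R_{ij}`. -/
noncomputable def Rmin (n : ℕ) {ν : ℕ} (z : Fin ν → Euc n) (lam : Fin ν → ℝ) : ℝ :=
  (1 / 2) * sInf {r : ℝ | ∃ i j, i ≠ j ∧ r = Rij n z lam i j}

/-- Japanese bracket `⟨y⟩ = (1+|y|²)^{1/2}`. -/
noncomputable def jbr {n : ℕ} (y : Euc n) : ℝ := Real.sqrt (1 + ‖y‖ ^ 2)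

/-- The weight function `V`. -/
noncomputable def Vwt (n : ℕ) (s : ℝ) {ν : ℕ} (z : Fin ν → Euc n) (lam : Fin ν → ℝ)
    (x : Euc n) : ℝ :=
  ∑ i, (lam i ^ (((n : ℝ) + 2 * s) / 2) * Rmin n z lam ^ (2 * s - (n : ℝ)) *
          jbr (lam i • (x - z i)) ^ (-(4 * s)) *
          (if ‖lam i • (x - z i)‖ ≤ Rmin n z lam then (1 : ℝ) else 0) +
        lam i ^ (((n : ℝ) + 2 * s) / 2) * Rmin n z lam ^ (-(4 * s)) *
          jbr (lam i • (x - z i)) ^ (2 * s - (n : ℝ)) *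
          (if Rmin n z lam / 2 ≤ ‖lam i • (x - z i)‖ then (1 : ℝ) else 0))

/-- The weight function `W`. -/
noncomputable def Wwt (n : ℕ) (s : ℝ) {ν : ℕ} (z : Fin ν → Euc n) (lam : Fin ν → ℝ)
    (x : Euc n) : ℝ :=
  ∑ i, (lam i ^ (((n : ℝ) - 2 * s) / 2) * Rmin n z lam ^ (2 * s - (n : ℝ)) *
          jbr (lam i • (x - z i)) ^ (-(2 * s)) *
          (if ‖lam i • (x - z i)‖ ≤ Rmin n z lam then (1 : ℝ) else 0) +
        lam i ^ (((n : ℝ) - 2 * s) / 2) * Rmin n z lam ^ (-(4 * s)) *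
          jbr (lam i • (x - z i)) ^ (4 * s - (n : ℝ)) *
          (if Rmin n z lam / 2 ≤ ‖lam i • (x - z i)‖ then (1 : ℝ) else 0))

/-- `‖φ‖_* = sup_x |φ(x)| W(x)⁻¹`. -/
noncomputable def starNorm (n : ℕ) (s : ℝ) {ν : ℕ} (z : Fin ν → Euc n) (lam : Fin ν → ℝ)
    (φ : Euc n → ℝ) : ℝ :=
  ⨆ x : Euc n, |φ x| / Wwt n s z lam x

/-- `‖h‖_{**} = sup_x |h(x)| V(x)⁻¹`. -/
noncomputable def dstarNorm (n : ℕ) (s : ℝ) {ν : ℕ} (z : Fin ν → Euc n) (lam : Fin ν → ℝ)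
    (h : Euc n → ℝ) : ℝ :=
  ⨆ x : Euc n, |h x| / Vwt n s z lam x

noncomputable def l2norm (n : ℕ) (f : Euc n → ℝ) : ℝ := Real.sqrt (∫ x, f x ^ 2)

/-- The error function `(-Δ)^s u - u|u|^{p-1}`. -/
noncomputable def errFun (n : ℕ) (s : ℝ) (u : Euc n → ℝ) : Euc n → ℝ :=
  fun x => fracLap n s u x - u x * |u x| ^ (pexp n s - 1)

open Set

/-- Integration in polar coordinates for nonnegative radial functions. -/
lemma lintegral_comp_norm {E : Type*} [NormedAddCommGroup E] [NormedSpace ℝ E] [Nontrivial E]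
    [MeasurableSpace E] [BorelSpace E] [FiniteDimensional ℝ E] (μ : Measure E)
    [μ.IsAddHaarMeasure] {f : ℝ → ENNReal} (hf : Measurable f) :
    ∫⁻ x, f ‖x‖ ∂μ = μ.toSphere univ *
      ∫⁻ t in Ioi (0 : ℝ), ENNReal.ofReal (t ^ (Module.finrank ℝ E - 1)) * f t := by
  calc
    ∫⁻ x, f ‖x‖ ∂μ = ∫⁻ x : ({(0)}ᶜ : Set E), f (‖x.1‖) ∂(μ.comap (↑)) := by
      rw [lintegral_subtype_comap (measurableSet_singleton _).compl fun x ↦ f (‖x‖),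
        restrict_compl_singleton]
    _ = ∫⁻ x, f x.2 ∂μ.toSphere.prod (.volumeIoiPow (Module.finrank ℝ E - 1)) := by
      simpa using μ.measurePreserving_homeomorphUnitSphereProd.lintegral_comp_emb
        (Homeomorph.measurableEmbedding _) (f ∘ Subtype.val ∘ Prod.snd)
    _ = μ.toSphere univ * ∫⁻ x : Ioi (0 : ℝ), f x ∂.volumeIoiPow (Module.finrank ℝ E - 1) := by
      rw [lintegral_prod _ (by fun_prop)]
      simp [mul_comm]
    _ = _ := by
      rw [Measure.volumeIoiPow, lintegral_withDensity_eq_lintegral_mul _ (by fun_prop)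
        (by fun_prop)]
      simp only [Pi.mul_apply]
      rw [lintegral_subtype_comap measurableSet_Ioi
        fun a ↦ ENNReal.ofReal (a ^ (Module.finrank ℝ E - 1)) * f a]

lemma lintegral_Ioc_rpow_le {q b : ℝ} (hq : 0 < q) (hb : 0 < b) :
    ∫⁻ t in Ioc 0 b, ENNReal.ofReal (b ^ (-q) * t ^ (q - 1)) ≤ ENNReal.ofReal (1 / q) := by
  have hi : IntegrableOn (fun t : ℝ => b ^ (-q) * t ^ (q - 1)) (Ioc 0 b) := by
    refine Integrable.const_mul ?_ _
    exact (intervalIntegrable_iff_integrableOn_Ioc_of_le hb.le).1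
      (intervalIntegral.intervalIntegrable_rpow' (by linarith))
  rw [← ofReal_integral_eq_lintegral_ofReal hi]
  · apply ENNReal.ofReal_le_ofReal
    rw [integral_const_mul, ← intervalIntegral.integral_of_le hb.le,
      integral_rpow (Or.inl (by linarith)), sub_add_cancel, Real.zero_rpow hq.ne', sub_zero,
      mul_div_assoc', ← Real.rpow_add hb]
    simp
  · filter_upwards [ae_restrict_mem measurableSet_Ioc] with t ht
    have := ht.1
    simp only [Pi.zero_apply]
    positivity

lemma lintegral_Ioi_rpow_le {q b : ℝ} (hq : 0 < q) (hb : 0 < b) :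
    ∫⁻ t in Ioi b, ENNReal.ofReal (b ^ q * t ^ (-q - 1)) ≤ ENNReal.ofReal (1 / q) := by
  have hi : IntegrableOn (fun t : ℝ => b ^ q * t ^ (-q - 1)) (Ioi b) :=
    Integrable.const_mul (integrableOn_Ioi_rpow_of_lt (by linarith) hb) _
  rw [← ofReal_integral_eq_lintegral_ofReal hi]
  · apply ENNReal.ofReal_le_ofReal
    rw [integral_const_mul, integral_Ioi_rpow_of_lt (by linarith) hb, sub_add_cancel,
      neg_div_neg_eq, mul_div_assoc', ← Real.rpow_add hb]
    simp
  · filter_upwards [ae_restrict_mem measurableSet_Ioi] with t ht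
    have : 0 < t := hb.trans ht
    simp only [Pi.zero_apply]
    positivity

lemma lintegral_abs_sub_rpow_le {s b : ℝ} (hs : s < 1) (hb : 0 < b) :
    ∫⁻ t in Ioc 0 (2 * b), ENNReal.ofReal (b ^ (s - 1) * |t - b| ^ (-s)) ≤
      2 * ENNReal.ofReal (1 / (1 - s)) := by
  have key : ∫⁻ t in Ioc 0 b, ENNReal.ofReal (b ^ (s - 1) * |t| ^ (-s)) ≤
      ENNReal.ofReal (1 / (1 - s)) := by
    refine le_trans (le_of_eq ?_) (lintegral_Ioc_rpow_le (q := 1 - s) (by linarith) hb)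
    refine setLIntegral_congr_fun measurableSet_Ioc fun t ht => ?_
    have ht0 : (0 : ℝ) < t := ht.1
    simp only [abs_of_pos ht0]
    congr 3 <;> ring
  have hsub : Ioc 0 (2 * b) ⊆ Ioc 0 b ∪ Ioc b (2 * b) := by
    rw [Ioc_union_Ioc_eq_Ioc hb.le (by linarith)]
  refine (lintegral_mono_set hsub).trans ((lintegral_union_le _ _ _).trans ?_)
  rw [two_mul (ENNReal.ofReal _)]
  apply add_le_add
  · refine le_trans (le_of_eq ?_) key
    have := (Measure.measurePreserving_sub_left volume b).setLIntegral_comp_emb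
      (MeasurableEquiv.subLeft b).measurableEmbedding
      (fun t => ENNReal.ofReal (b ^ (s - 1) * |t| ^ (-s))) (Ico 0 b)
    rw [restrict_Ico_eq_restrict_Ioc] at this
    simp only [image_const_sub_Ico, sub_zero, sub_self] at this
    rw [← this]
    exact lintegral_congr fun t => by rw [abs_sub_comm]
  · refine le_trans (le_of_eq ?_) key
    have := (measurePreserving_sub_right volume b).setLIntegral_comp_emb
      (MeasurableEquiv.subRight b).measurableEmbedding
      (fun t => ENNReal.ofReal (b ^ (s - 1) * |t| ^ (-s))) (Ioc b (2 * b))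
    simp only [image_sub_const_Ioc, sub_self] at this
    rw [show 2 * b - b = b by ring] at this
    exact this

lemma lintegral_Ioc_inv_eq {a b : ℝ} (ha : 0 < a) (hab : a ≤ b) :
    ∫⁻ t in Ioc a b, ENNReal.ofReal t⁻¹ = ENNReal.ofReal (Real.log b - Real.log a) := by
  have hi : IntegrableOn (fun t : ℝ => t⁻¹) (Ioc a b) := by
    refine (intervalIntegrable_iff_integrableOn_Ioc_of_le hab).1 ?_
    refine intervalIntegral.intervalIntegrable_inv (fun x hx => ?_) continuousOn_id
    rw [uIcc_of_le hab] at hx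
    exact (ha.trans_le hx.1).ne'
  rw [← ofReal_integral_eq_lintegral_ofReal hi]
  · rw [← intervalIntegral.integral_of_le hab, integral_inv_of_pos ha (ha.trans_le hab),
      Real.log_div (ha.trans_le hab).ne' ha.ne']
  · filter_upwards [ae_restrict_mem measurableSet_Ioc] with t ht
    have : 0 < t := ha.trans ht.1
    simp only [Pi.zero_apply]
    positivity

/-- The bound, up to a constant, for the mass of the kernel `|x - z|^{-n-s}` over those `z` that the
sphere of radius `ρ` separates from a point `x` with `|x| = t`. -/
def sphereBound (n : ℕ) (s t ρ : ℝ) : ℝ :=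
  if t ≤ 2 * ρ then |t - ρ| ^ (-s) else ρ ^ (n : ℝ) * t ^ (-((n : ℝ) + s))

lemma measurable_sphereBound (n : ℕ) (s : ℝ) :
    Measurable fun q : ℝ × ℝ => sphereBound n s q.1 q.2 := by
  unfold sphereBound
  refine Measurable.ite (measurableSet_le (by fun_prop) (by fun_prop)) ?_ ?_ <;> fun_prop

lemma lintegral_rpow_mul_sphereBound_le {n : ℕ} {s : ℝ} (hn : 0 < n) (hs0 : 0 < s) (hs1 : s < 1)
    {ρ : ℝ} (hρ : 0 < ρ) :
    ∫⁻ t in Ioi 0, ENNReal.ofReal (t ^ (s - 1) * sphereBound n s t ρ) ≤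
      ENNReal.ofReal (2 ^ s) * ENNReal.ofReal (1 / s) +
        ENNReal.ofReal (2 ^ (1 - s)) * (2 * ENNReal.ofReal (1 / (1 - s))) +
        ENNReal.ofReal (1 / n) := by
  have hn' : (0 : ℝ) < n := by exact_mod_cast hn
  have hsub : Ioi (0 : ℝ) ⊆ (Ioc 0 (ρ / 2) ∪ Ioc (ρ / 2) (2 * ρ)) ∪ Ioi (2 * ρ) := by
    rw [Ioc_union_Ioc_eq_Ioc (by positivity) (by linarith), Ioc_union_Ioi_eq_Ioi (by linarith)]
  refine (lintegral_mono_set hsub).trans ((lintegral_union_le _ _ _).trans ?_)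
  refine add_le_add ((lintegral_union_le _ _ _).trans (add_le_add ?_ ?_)) ?_
  · refine le_trans ?_ (mul_le_mul_right (lintegral_Ioc_rpow_le hs0 hρ) _)
    rw [← lintegral_const_mul' _ _ ENNReal.ofReal_ne_top]
    refine le_trans ?_ (lintegral_mono_set (Ioc_subset_Ioc_right (by linarith : ρ / 2 ≤ ρ)))
    refine setLIntegral_mono' measurableSet_Ioc fun t ht => ?_
    have ht0 : (0 : ℝ) < t := ht.1
    have ht1 : t ≤ ρ / 2 := ht.2
    rw [← ENNReal.ofReal_mul (by positivity)]
    apply ENNReal.ofReal_le_ofReal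
    rw [sphereBound, if_pos (by linarith), mul_comm, ← mul_assoc]
    refine mul_le_mul_of_nonneg_right ?_ (by positivity)
    have h1 : |t - ρ| ^ (-s) ≤ (ρ / 2) ^ (-s) := by
      apply Real.rpow_le_rpow_of_nonpos (by positivity) _ (by linarith)
      rw [abs_sub_comm, abs_of_nonneg (by linarith)]
      linarith
    refine h1.trans (le_of_eq ?_)
    rw [Real.div_rpow hρ.le (by norm_num), Real.rpow_neg (by norm_num : (0:ℝ) ≤ 2)]
    field_simp
  · refine le_trans ?_ (mul_le_mul_right (lintegral_abs_sub_rpow_le hs1 hρ) _)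
    rw [← lintegral_const_mul' _ _ ENNReal.ofReal_ne_top]
    refine le_trans ?_ (lintegral_mono_set
      (Ioc_subset_Ioc_left (by linarith : (0 : ℝ) ≤ ρ / 2)))
    refine setLIntegral_mono' measurableSet_Ioc fun t ht => ?_
    have ht1 : ρ / 2 < t := ht.1
    have ht0 : (0 : ℝ) < t := by linarith
    have ht2 : t ≤ 2 * ρ := ht.2
    rw [← ENNReal.ofReal_mul (by positivity)]
    apply ENNReal.ofReal_le_ofReal
    rw [sphereBound, if_pos (by linarith), ← mul_assoc]
    refine mul_le_mul_of_nonneg_right ?_ (by positivity)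
    have h1 : t ^ (s - 1) ≤ (ρ / 2) ^ (s - 1) :=
      Real.rpow_le_rpow_of_nonpos (by positivity) ht1.le (by linarith)
    refine h1.trans (le_of_eq ?_)
    rw [Real.div_rpow hρ.le (by norm_num), ← neg_sub, Real.rpow_neg (by norm_num : (0:ℝ) ≤ 2)]
    field_simp
  · refine le_trans ?_ (lintegral_Ioi_rpow_le hn' hρ)
    refine le_trans ?_ (lintegral_mono_set (Ioi_subset_Ioi (by linarith : ρ ≤ 2 * ρ)))
    refine setLIntegral_mono' measurableSet_Ioi fun t ht => ?_
    have ht1 : 2 * ρ < t := ht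
    have ht0 : (0 : ℝ) < t := by linarith
    apply ENNReal.ofReal_le_ofReal
    rw [sphereBound, if_neg (by linarith), mul_left_comm, ← Real.rpow_add ht0]
    apply le_of_eq
    congr 2
    ring

lemma lintegral_inv_mul_sphereBound_le {n : ℕ} {s : ℝ} (hn : 0 < n) (hs0 : 0 < s) (hs1 : s < 1)
    {a : ℝ} (ha : 0 < a) :
    ∫⁻ ρ in Ioi 0, ENNReal.ofReal (a ^ s * (ρ⁻¹ * sphereBound n s a ρ)) ≤
      ENNReal.ofReal (1 / n) + ENNReal.ofReal 2 * (2 * ENNReal.ofReal (1 / (1 - s))) +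
        ENNReal.ofReal (2 ^ s) * ENNReal.ofReal (1 / s) := by
  have hn' : (0 : ℝ) < n := by exact_mod_cast hn
  have hsub : Ioi (0 : ℝ) ⊆ (Ioo 0 (a / 2) ∪ Icc (a / 2) (2 * a)) ∪ Ioi (2 * a) := by
    intro x hx
    have hx : 0 < x := hx
    simp only [mem_union, mem_Ioo, mem_Icc, mem_Ioi]
    by_cases h1 : x < a / 2 <;> by_cases h2 : x ≤ 2 * a <;> grind
  refine (lintegral_mono_set hsub).trans ((lintegral_union_le _ _ _).trans ?_)
  refine add_le_add ((lintegral_union_le _ _ _).trans (add_le_add ?_ ?_)) ?_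
  · refine le_trans ?_ (lintegral_Ioc_rpow_le hn' ha)
    refine le_trans ?_ (lintegral_mono_set (Ioo_subset_Ioc_self.trans
      (Ioc_subset_Ioc_right (by linarith : a / 2 ≤ a))))
    refine setLIntegral_mono' measurableSet_Ioo fun t ht => ?_
    have ht0 : (0 : ℝ) < t := ht.1
    have ht1 : t < a / 2 := ht.2
    apply ENNReal.ofReal_le_ofReal
    rw [sphereBound, if_neg (by linarith)]
    apply le_of_eq
    rw [neg_add, Real.rpow_add ha, Real.rpow_sub ht0, Real.rpow_one, Real.rpow_neg ha.le s]
    field_simp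
  · refine le_trans ?_ (mul_le_mul_right (lintegral_abs_sub_rpow_le hs1 ha) _)
    rw [← lintegral_const_mul' _ _ ENNReal.ofReal_ne_top]
    refine le_trans ?_ (lintegral_mono_set
      (fun t ht => ⟨by linarith [ht.1], ht.2⟩ : Icc (a / 2) (2 * a) ⊆ Ioc 0 (2 * a)))
    refine setLIntegral_mono' measurableSet_Icc fun t ht => ?_
    have ht1 : a / 2 ≤ t := ht.1
    have ht0 : (0 : ℝ) < t := by linarith
    rw [← ENNReal.ofReal_mul (by positivity)]
    apply ENNReal.ofReal_le_ofReal
    rw [sphereBound, if_pos (by linarith), abs_sub_comm, ← mul_assoc, ← mul_assoc]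
    refine mul_le_mul_of_nonneg_right ?_ (by positivity)
    rw [Real.rpow_sub ha, Real.rpow_one, mul_div_assoc', mul_comm, ← div_eq_inv_mul,
      div_le_div_iff₀ ht0 ha]
    have : 0 < a ^ s := by positivity
    nlinarith
  · refine le_trans ?_ (mul_le_mul_right (lintegral_Ioi_rpow_le hs0 ha) _)
    rw [← lintegral_const_mul' _ _ ENNReal.ofReal_ne_top]
    refine le_trans ?_ (lintegral_mono_set (Ioi_subset_Ioi (by linarith : a ≤ 2 * a)))
    refine setLIntegral_mono' measurableSet_Ioi fun t ht => ?_
    have ht1 : 2 * a < t := ht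
    have ht0 : (0 : ℝ) < t := by linarith
    rw [← ENNReal.ofReal_mul (by positivity)]
    apply ENNReal.ofReal_le_ofReal
    rw [sphereBound, if_pos (by linarith)]
    have h1 : |a - t| ^ (-s) ≤ (t / 2) ^ (-s) := by
      apply Real.rpow_le_rpow_of_nonpos (by positivity) _ (by linarith)
      rw [abs_sub_comm, abs_of_nonneg (by linarith)]
      linarith
    refine (mul_le_mul_of_nonneg_left (mul_le_mul_of_nonneg_left h1 (by positivity))
      (by positivity)).trans (le_of_eq ?_)
    rw [Real.div_rpow ht0.le (by norm_num), Real.rpow_sub ht0, Real.rpow_one,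
      Real.rpow_neg (by norm_num : (0:ℝ) ≤ 2)]
    field_simp

/-- The kernel `|y|^{-n-s}`. -/
def fracKer (n : ℕ) (s : ℝ) (y : Euc n) : ENNReal := ENNReal.ofReal (‖y‖ ^ (-((n : ℝ) + s)))

lemma measurable_fracKer (n : ℕ) (s : ℝ) : Measurable (fracKer n s) := by
  unfold fracKer
  fun_prop

/-- The points of `ℝⁿ` separated from `x` by the sphere of radius `ρ`. -/
def separated (n : ℕ) (ρ : ℝ) (x : Euc n) : Set (Euc n) :=
  {z | min ‖x‖ ‖z‖ < ρ ∧ ρ ≤ max ‖x‖ ‖z‖}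

/-- The mass of the kernel centred at `x` over the points separated from `x`. -/
def separatedMass (n : ℕ) (s ρ : ℝ) (x : Euc n) : ENNReal :=
  ∫⁻ z, (separated n ρ x).indicator (fun z => fracKer n s (x - z)) z

lemma lintegral_fracKer_compl_ball_le {n : ℕ} {s : ℝ} (hn : 0 < n) (hs0 : 0 < s)
    (x : Euc n) {d : ℝ} (hd : 0 < d) :
    ∫⁻ z, {z : Euc n | d ≤ ‖x - z‖}.indicator (fun z => fracKer n s (x - z)) z ≤
      (volume : Measure (Euc n)).toSphere univ * ENNReal.ofReal (1 / s) *
        ENNReal.ofReal (d ^ (-s)) := by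
  have : Nonempty (Fin n) := ⟨⟨0, hn⟩⟩
  have hm : Measurable
      ((Ici d).indicator fun t : ℝ => ENNReal.ofReal (t ^ (-((n : ℝ) + s)))) :=
    Measurable.indicator (by fun_prop) measurableSet_Ici
  have h1 : ∫⁻ z, {z : Euc n | d ≤ ‖x - z‖}.indicator (fun z => fracKer n s (x - z)) z =
      ∫⁻ y : Euc n, (Ici d).indicator (fun t : ℝ => ENNReal.ofReal (t ^ (-((n : ℝ) + s)))) ‖y‖ := by
    rw [← lintegral_sub_left_eq_self _ x]
    exact lintegral_congr fun y => by simp [indicator, fracKer]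
  rw [h1, lintegral_comp_norm volume hm, mul_assoc]
  gcongr
  have h2 : ∀ t ∈ Ioi (0 : ℝ), ENNReal.ofReal (t ^ (Module.finrank ℝ (Euc n) - 1)) *
      (Ici d).indicator (fun t : ℝ => ENNReal.ofReal (t ^ (-((n : ℝ) + s)))) t =
      (Ici d).indicator (fun t => ENNReal.ofReal (d ^ (-s)) *
        ENNReal.ofReal (d ^ s * t ^ (-s - 1))) t := by
    intro t ht
    have ht : 0 < t := ht
    by_cases htd : t ∈ Ici d
    · rw [indicator_of_mem htd, indicator_of_mem htd, ← ENNReal.ofReal_mul (by positivity),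
        ← ENNReal.ofReal_mul (by positivity), ← mul_assoc, ← Real.rpow_add hd,
        ← Real.rpow_natCast, ← Real.rpow_add ht, finrank_euclideanSpace_fin, Nat.cast_sub hn]
      simp only [neg_add_cancel, Real.rpow_zero, one_mul]
      congr 2
      push_cast
      ring
    · simp [htd]
  rw [setLIntegral_congr_fun measurableSet_Ioi h2, mul_comm, ← lintegral_indicator measurableSet_Ioi]
  refine le_trans ?_ (mul_le_mul_right (lintegral_Ioi_rpow_le hs0 hd) _)
  rw [← lintegral_const_mul' _ _ ENNReal.ofReal_ne_top, restrict_Ioi_eq_restrict_Ici,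
    ← lintegral_indicator measurableSet_Ici]
  refine lintegral_mono fun t => ?_
  exact indicator_apply_le' (fun _ => le_rfl) (fun _ => zero_le)

lemma exists_separatedMass_le {n : ℕ} {s : ℝ} (hn : 0 < n) (hs0 : 0 < s) :
    ∃ M : ENNReal, M ≠ ⊤ ∧ ∀ (ρ : ℝ) (x : Euc n), 0 < ρ → ‖x‖ ≠ ρ →
      separatedMass n s ρ x ≤ M * ENNReal.ofReal (sphereBound n s ‖x‖ ρ) := by
  have : Nonempty (Fin n) := ⟨⟨0, hn⟩⟩
  set M1 := (volume : Measure (Euc n)).toSphere univ * ENNReal.ofReal (1 / s) with hM1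
  set M2 := ENNReal.ofReal (2 ^ ((n : ℝ) + s)) * volume (Metric.ball (0 : Euc n) 1) with hM2
  have hM1' : M1 ≠ ⊤ := by finiteness
  have hM2' : M2 ≠ ⊤ := ENNReal.mul_ne_top (by finiteness) measure_ball_lt_top.ne
  refine ⟨M1 + M2, by finiteness, fun ρ x hρ hx => ?_⟩
  unfold sphereBound
  split_ifs with h
  · refine le_trans ?_ (mul_le_mul_left (self_le_add_right M1 M2) _)
    refine le_trans (lintegral_mono fun z => ?_)
      (lintegral_fracKer_compl_ball_le hn hs0 x (abs_pos.2 (sub_ne_zero.2 hx)))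
    refine indicator_le_indicator_of_subset ?_ (fun _ => zero_le) z
    rintro z ⟨h1, h2⟩
    have h3 := abs_norm_sub_norm_le x z
    refine le_trans ?_ h3
    rcases le_total ‖x‖ ‖z‖ with h4 | h4
    · rw [min_eq_left h4] at h1
      rw [max_eq_right h4] at h2
      rw [abs_of_nonpos (by linarith), abs_of_nonpos (by linarith)]
      linarith
    · rw [min_eq_right h4] at h1
      rw [max_eq_left h4] at h2
      rw [abs_of_nonneg (by linarith), abs_of_nonneg (by linarith)]
      linarith
  · push Not at h
    have hx0 : 0 < ‖x‖ := by linarith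
    refine le_trans ?_ (mul_le_mul_left (self_le_add_left M2 M1) _)
    have h1 : ∀ z, (separated n ρ x).indicator (fun z => fracKer n s (x - z)) z ≤
        (Metric.ball (0 : Euc n) ρ).indicator
          (fun _ => ENNReal.ofReal ((‖x‖ / 2) ^ (-((n : ℝ) + s)))) z := by
      intro z
      refine indicator_apply_le' ?_ (fun _ => zero_le)
      rintro ⟨hz, -⟩
      have hz' : ‖z‖ < ρ := (min_lt_iff.1 hz).resolve_left (by linarith)
      rw [indicator_of_mem (by simpa using hz')]
      apply ENNReal.ofReal_le_ofReal
      apply Real.rpow_le_rpow_of_nonpos (by positivity) _ (by linarith [n.cast_nonneg (α := ℝ)])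
      linarith [norm_sub_norm_le x z]
    refine (lintegral_mono h1).trans (le_of_eq ?_)
    rw [lintegral_indicator_const measurableSet_ball, Measure.addHaar_ball _ _ hρ.le,
      finrank_euclideanSpace_fin, ← mul_assoc, ← ENNReal.ofReal_mul (by positivity), hM2,
      mul_right_comm, ← ENNReal.ofReal_mul (by positivity)]
    congr 2
    rw [Real.div_rpow hx0.le (by norm_num), Real.rpow_neg (by norm_num : (0:ℝ) ≤ 2),
      Real.rpow_natCast]
    field_simp

lemma exists_lintegral_rpow_mul_separatedMass_le {n : ℕ} {s : ℝ} (hn : 0 < n) (hs0 : 0 < s)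
    (hs1 : s < 1) :
    ∃ M : ENNReal, M ≠ ⊤ ∧ ∀ ρ : ℝ, 0 < ρ →
      ∫⁻ x : Euc n, ENNReal.ofReal (‖x‖ ^ (s - n)) * separatedMass n s ρ x ≤ M := by
  have : Nonempty (Fin n) := ⟨⟨0, hn⟩⟩
  obtain ⟨M, hM, h⟩ := exists_separatedMass_le (n := n) hn hs0
  refine ⟨M * ((volume : Measure (Euc n)).toSphere univ *
    (ENNReal.ofReal (2 ^ s) * ENNReal.ofReal (1 / s) +
        ENNReal.ofReal (2 ^ (1 - s)) * (2 * ENNReal.ofReal (1 / (1 - s))) +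
        ENNReal.ofReal (1 / n))), by finiteness, fun ρ hρ => ?_⟩
  have hm : Measurable fun t : ℝ => ENNReal.ofReal (t ^ (s - n) * sphereBound n s t ρ) := by
    have := (measurable_sphereBound n s).comp (measurable_id.prodMk (measurable_const (a := ρ)))
    exact ((by fun_prop : Measurable fun t : ℝ => t ^ (s - n)).mul this).ennreal_ofReal
  calc
    _ ≤ ∫⁻ x : Euc n, M * ENNReal.ofReal (‖x‖ ^ (s - n) * sphereBound n s ‖x‖ ρ) := by
      apply lintegral_mono_ae
      have : ∀ᵐ x : Euc n, x ∉ Metric.sphere 0 ρ := by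
        rw [← measure_eq_zero_iff_ae_notMem]
        exact Measure.addHaar_sphere _ _ _
      filter_upwards [this] with x hx
      rw [ENNReal.ofReal_mul (by positivity), mul_left_comm]
      exact mul_le_mul_right (h ρ x hρ (by simpa using hx)) _
    _ = M * ∫⁻ x : Euc n, ENNReal.ofReal (‖x‖ ^ (s - n) * sphereBound n s ‖x‖ ρ) :=
      lintegral_const_mul' _ _ hM
    _ ≤ _ := by
      rw [lintegral_comp_norm volume hm]
      gcongr
      refine le_trans (le_of_eq ?_) (lintegral_rpow_mul_sphereBound_le hn hs0 hs1 hρ)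
      refine setLIntegral_congr_fun measurableSet_Ioi fun t ht => ?_
      have ht : 0 < t := ht
      rw [← ENNReal.ofReal_mul (by positivity), ← mul_assoc, ← Real.rpow_natCast,
        ← Real.rpow_add ht, finrank_euclideanSpace_fin, Nat.cast_sub hn]
      congr 3
      push_cast
      ring

lemma exists_lintegral_inv_mul_separatedMass_le {n : ℕ} {s : ℝ} (hn : 0 < n) (hs0 : 0 < s)
    (hs1 : s < 1) :
    ∃ M : ENNReal, M ≠ ⊤ ∧ ∀ x : Euc n, x ≠ 0 →
      ENNReal.ofReal (‖x‖ ^ s) *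
        ∫⁻ ρ in Ioi 0, ENNReal.ofReal ρ⁻¹ * separatedMass n s ρ x ≤ M := by
  obtain ⟨M, hM, h⟩ := exists_separatedMass_le (n := n) hn hs0
  refine ⟨M * (ENNReal.ofReal (1 / n) + ENNReal.ofReal 2 * (2 * ENNReal.ofReal (1 / (1 - s))) +
        ENNReal.ofReal (2 ^ s) * ENNReal.ofReal (1 / s)), by finiteness, fun x hx => ?_⟩
  have hx0 : 0 < ‖x‖ := norm_pos_iff.2 hx
  refine le_trans ?_ (mul_le_mul_right (lintegral_inv_mul_sphereBound_le hn hs0 hs1 hx0) M)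
  rw [← lintegral_const_mul' _ _ hM, ← lintegral_const_mul' _ _ ENNReal.ofReal_ne_top]
  apply lintegral_mono_ae
  have : ∀ᵐ ρ : ℝ ∂(volume.restrict (Ioi 0)), ρ ∉ ({‖x‖} : Set ℝ) := by
    rw [← measure_eq_zero_iff_ae_notMem]
    simp
  filter_upwards [this, ae_restrict_mem measurableSet_Ioi] with ρ hρ hρ0
  have hρ0 : 0 < ρ := hρ0
  rw [ENNReal.ofReal_mul (by positivity), ENNReal.ofReal_mul (by positivity), mul_left_comm M,
    mul_left_comm M]
  gcongr
  exact h ρ x hρ0 (fun h => hρ (by simp [h]))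

lemma measurable_separatedIndicator (n : ℕ) (s : ℝ) :
    Measurable fun q : (ℝ × Euc n) × Euc n =>
      (separated n q.1.1 q.1.2).indicator (fun z => fracKer n s (q.1.2 - z)) q.2 := by
  have hS : MeasurableSet {q : (ℝ × Euc n) × Euc n | q.2 ∈ separated n q.1.1 q.1.2} := by
    refine measurableSet_setOfPred.2 ?_
    refine Measurable.and (measurableSet_setOfPred.1 (measurableSet_lt ?_ ?_))
      (measurableSet_setOfPred.1 (measurableSet_le ?_ ?_)) <;> fun_prop
  have hf : Measurable fun q : (ℝ × Euc n) × Euc n => fracKer n s (q.1.2 - q.2) :=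
    (measurable_fracKer n s).comp (by fun_prop)
  exact hf.indicator hS

lemma measurable_separatedMass (n : ℕ) (s : ℝ) :
    Measurable fun q : ℝ × Euc n => separatedMass n s q.1 q.2 :=
  (measurable_separatedIndicator n s).lintegral_prod_right'

/-- The radial profile of the logarithmic cutoff: `1` up to `r`, `0` from `R` on, and affine in
`log t` in between. -/
def logProfile (r R t : ℝ) : ℝ :=
  (Real.log R - Real.log (max r (min t R))) / Real.log (R / r)

section logProfile

variable {r R : ℝ}

lemma logProfile_of_le (hr : 0 < r) (hrR : r < R) {t : ℝ} (ht : t ≤ r) :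
    logProfile r R t = 1 := by
  have : 0 < Real.log (R / r) := Real.log_pos ((one_lt_div hr).2 hrR)
  rw [logProfile, max_eq_left ((min_le_left _ _).trans ht), ← Real.log_div (hr.trans hrR).ne' hr.ne',
    div_self this.ne']

lemma logProfile_of_ge (hrR : r < R) {t : ℝ} (ht : R ≤ t) : logProfile r R t = 0 := by
  rw [logProfile, min_eq_right ht, max_eq_right hrR.le, sub_self, zero_div]

lemma logProfile_antitone (hr : 0 < r) (hrR : r < R) : Antitone (logProfile r R) := by
  intro a b hab
  have : 0 < Real.log (R / r) := Real.log_pos ((one_lt_div hr).2 hrR)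
  unfold logProfile
  gcongr

lemma logProfile_mem_Icc (hr : 0 < r) (hrR : r < R) (t : ℝ) :
    logProfile r R t ∈ Icc (0 : ℝ) 1 := by
  constructor
  · rw [← logProfile_of_ge hrR (le_max_right t R)]
    exact logProfile_antitone hr hrR (le_max_left _ _)
  · rw [← logProfile_of_le hr hrR (min_le_right t r)]
    exact logProfile_antitone hr hrR (min_le_left _ _)

lemma logProfile_sub_le (hr : 0 < r) (hrR : r < R) {a b : ℝ} (hab : a ≤ b) :
    ENNReal.ofReal (logProfile r R a - logProfile r R b) ≤
      ENNReal.ofReal (1 / Real.log (R / r)) *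
        ∫⁻ ρ in Ioc r R, (Ioc a b).indicator (fun ρ => ENNReal.ofReal ρ⁻¹) ρ := by
  have hL : 0 < Real.log (R / r) := Real.log_pos ((one_lt_div hr).2 hrR)
  have hc : max r (min a R) ≤ max r (min b R) := by gcongr
  have h0 : logProfile r R a - logProfile r R b = 1 / Real.log (R / r) *
      (Real.log (max r (min b R)) - Real.log (max r (min a R))) := by
    unfold logProfile
    ring
  rw [h0, ENNReal.ofReal_mul (by positivity),
    ← lintegral_Ioc_inv_eq (lt_max_of_lt_left hr) hc,
    lintegral_indicator measurableSet_Ioc, Measure.restrict_restrict measurableSet_Ioc]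
  gcongr
  rintro ρ ⟨h1, h2⟩
  simp only [max_lt_iff, min_lt_iff, le_max_iff, le_min_iff] at h1 h2
  simp only [mem_inter_iff, mem_Ioc]
  grind

lemma abs_logProfile_sub_le (hr : 0 < r) (hrR : r < R) (a b : ℝ) :
    ENNReal.ofReal |logProfile r R a - logProfile r R b| ≤
      ENNReal.ofReal (1 / Real.log (R / r)) *
        ∫⁻ ρ in Ioc r R, (Ioc (min a b) (max a b)).indicator (fun ρ => ENNReal.ofReal ρ⁻¹) ρ := by
  rcases le_total a b with h | h
  · rw [min_eq_left h, max_eq_right h, abs_of_nonneg (sub_nonneg.2 (logProfile_antitone hr hrR h))]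
    exact logProfile_sub_le hr hrR h
  · rw [min_eq_right h, max_eq_left h, abs_sub_comm,
      abs_of_nonneg (sub_nonneg.2 (logProfile_antitone hr hrR h))]
    exact logProfile_sub_le hr hrR h

lemma exists_lipschitzWith_logProfile (hr : 0 < r) (hrR : r < R) :
    ∃ K : NNReal, LipschitzWith K (logProfile r R) := by
  have hL : 0 < Real.log (R / r) := Real.log_pos ((one_lt_div hr).2 hrR)
  have key : ∀ a b : ℝ, a ≤ b →
      logProfile r R a - logProfile r R b ≤ 1 / (r * Real.log (R / r)) * (b - a) := by
    intro a b hab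
    have hc : max r (min a R) ≤ max r (min b R) := by gcongr
    have hd : max r (min b R) - max r (min a R) ≤ b - a := by grind
    set c := max r (min a R) with hcdef
    set d := max r (min b R) with hddef
    have hrc : r ≤ c := le_max_left _ _
    have hc0 : 0 < c := hr.trans_le hrc
    have h1 : Real.log d - Real.log c ≤ (b - a) / r := by
      rw [← Real.log_div (hc0.trans_le hc).ne' hc0.ne']
      refine (Real.log_le_sub_one_of_pos (div_pos (hc0.trans_le hc) hc0)).trans ?_
      rw [div_sub_one hc0.ne']
      exact div_le_div₀ (by linarith) hd hr hrc
    have h0 : logProfile r R a - logProfile r R b =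
        (Real.log d - Real.log c) / Real.log (R / r) := by
      unfold logProfile
      ring
    rw [h0, div_le_iff₀ hL]
    refine h1.trans (le_of_eq ?_)
    field_simp
  refine ⟨⟨1 / (r * Real.log (R / r)), by positivity⟩, LipschitzWith.of_dist_le_mul fun a b => ?_⟩
  simp only [Real.dist_eq]
  rcases le_total a b with h | h
  · rw [abs_of_nonneg (sub_nonneg.2 (logProfile_antitone hr hrR h)), abs_sub_comm,
      abs_of_nonneg (sub_nonneg.2 h)]
    exact key a b h
  · rw [abs_sub_comm, abs_of_nonneg (sub_nonneg.2 (logProfile_antitone hr hrR h)),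
      abs_of_nonneg (sub_nonneg.2 h)]
    exact key b a h

end logProfile

/-- The absolute singular integral `∫ |φ(x) - φ(z)| |x - z|^{-n-s} dz` for the logarithmic cutoff `φ`
centred at the origin. -/
def cutoffVariation (n : ℕ) (s r R : ℝ) (x : Euc n) : ENNReal :=
  ∫⁻ z : Euc n, ENNReal.ofReal |logProfile r R ‖x‖ - logProfile r R ‖z‖| * fracKer n s (x - z)

lemma cutoffVariation_le {n : ℕ} {s r R : ℝ} (hr : 0 < r) (hrR : r < R) (x : Euc n) :
    cutoffVariation n s r R x ≤ ENNReal.ofReal (1 / Real.log (R / r)) *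
      ∫⁻ ρ in Ioc r R, ENNReal.ofReal ρ⁻¹ * separatedMass n s ρ x := by
  calc
    cutoffVariation n s r R x ≤ ∫⁻ z : Euc n, ENNReal.ofReal (1 / Real.log (R / r)) *
        ∫⁻ ρ in Ioc r R, ENNReal.ofReal ρ⁻¹ *
          (separated n ρ x).indicator (fun z => fracKer n s (x - z)) z := by
      refine lintegral_mono fun z => ?_
      refine (mul_le_mul_left (abs_logProfile_sub_le hr hrR _ _) _).trans (le_of_eq ?_)
      rw [mul_assoc, ← lintegral_mul_const' _ _ (show fracKer n s (x - z) ≠ ⊤ from ENNReal.ofReal_ne_top)]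
      congr 1
      refine lintegral_congr fun ρ => ?_
      by_cases h : z ∈ separated n ρ x
      · rw [indicator_of_mem h, indicator_of_mem (show ρ ∈ Ioc _ _ from h)]
      · rw [indicator_of_notMem h, indicator_of_notMem (show ρ ∉ Ioc _ _ from h)]
        simp
    _ = _ := by
      rw [lintegral_const_mul' _ _ ENNReal.ofReal_ne_top, lintegral_lintegral_swap]
      · congr 1
        refine lintegral_congr fun ρ => ?_
        rw [lintegral_const_mul' _ _ ENNReal.ofReal_ne_top]
        rfl
      · have h1 := (measurable_separatedIndicator n s).comp
          (by fun_prop : Measurable fun q : Euc n × ℝ => ((q.2, x), q.1))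
        exact ((by fun_prop : Measurable fun q : Euc n × ℝ => ENNReal.ofReal (q.2)⁻¹).mul
          h1).aemeasurable

lemma exists_cutoffVariation_le {n : ℕ} {s : ℝ} (hn : 0 < n) (hs0 : 0 < s) (hs1 : s < 1) :
    ∃ M : ENNReal, M ≠ ⊤ ∧ ∀ (r R : ℝ) (x : Euc n), 0 < r → r < R → x ≠ 0 →
      cutoffVariation n s r R x ≤
        ENNReal.ofReal (‖x‖ ^ (-s)) * (M * ENNReal.ofReal (1 / Real.log (R / r))) := by
  obtain ⟨M, hM, h⟩ := exists_lintegral_inv_mul_separatedMass_le hn hs0 hs1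
  refine ⟨M, hM, fun r R x hr hrR hx => ?_⟩
  have hx0 : 0 < ‖x‖ := norm_pos_iff.2 hx
  refine (cutoffVariation_le hr hrR x).trans ?_
  have h1 : ∫⁻ ρ in Ioc r R, ENNReal.ofReal ρ⁻¹ * separatedMass n s ρ x ≤
      ENNReal.ofReal (‖x‖ ^ (-s)) * M := by
    have hsub : Ioc r R ⊆ Ioi 0 := fun ρ hρ => hr.trans hρ.1
    refine (lintegral_mono_set hsub).trans ?_
    refine le_trans (le_of_eq ?_) (mul_le_mul_right (h x hx) _)
    rw [← mul_assoc, ← ENNReal.ofReal_mul (by positivity), ← Real.rpow_add hx0]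
    simp
  rw [mul_comm, ← mul_assoc]
  gcongr

lemma exists_lintegral_rpow_mul_cutoffVariation_le {n : ℕ} {s : ℝ} (hn : 0 < n) (hs0 : 0 < s)
    (hs1 : s < 1) :
    ∃ M : ENNReal, M ≠ ⊤ ∧ ∀ r R : ℝ, 0 < r → r < R →
      ∫⁻ x : Euc n, ENNReal.ofReal (‖x‖ ^ (s - n)) * cutoffVariation n s r R x ≤ M := by
  obtain ⟨M, hM, h⟩ := exists_lintegral_rpow_mul_separatedMass_le hn hs0 hs1
  refine ⟨M, hM, fun r R hr hrR => ?_⟩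
  have hL : 0 < Real.log (R / r) := Real.log_pos ((one_lt_div hr).2 hrR)
  calc
    _ ≤ ∫⁻ x : Euc n, ENNReal.ofReal (1 / Real.log (R / r)) * ∫⁻ ρ in Ioc r R,
        ENNReal.ofReal ρ⁻¹ * (ENNReal.ofReal (‖x‖ ^ (s - n)) * separatedMass n s ρ x) := by
      refine lintegral_mono fun x => ?_
      refine (mul_le_mul_right (cutoffVariation_le hr hrR x) _).trans (le_of_eq ?_)
      rw [mul_left_comm, ← lintegral_const_mul' _ _ ENNReal.ofReal_ne_top]
      simp_rw [mul_left_comm (ENNReal.ofReal (‖x‖ ^ (s - n)))]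
    _ = ENNReal.ofReal (1 / Real.log (R / r)) * ∫⁻ ρ in Ioc r R, ENNReal.ofReal ρ⁻¹ *
          ∫⁻ x : Euc n, ENNReal.ofReal (‖x‖ ^ (s - n)) * separatedMass n s ρ x := by
      rw [lintegral_const_mul' _ _ ENNReal.ofReal_ne_top, lintegral_lintegral_swap]
      · congr 1
        exact lintegral_congr fun ρ => lintegral_const_mul' _ _ ENNReal.ofReal_ne_top
      · have h1 := (measurable_separatedMass n s).comp
          (by fun_prop : Measurable fun q : Euc n × ℝ => (q.2, q.1))
        exact ((by fun_prop : Measurable fun q : Euc n × ℝ => ENNReal.ofReal (q.2)⁻¹).mul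
          ((by fun_prop : Measurable fun q : Euc n × ℝ =>
            ENNReal.ofReal (‖q.1‖ ^ (s - n))).mul h1)).aemeasurable
    _ ≤ ENNReal.ofReal (1 / Real.log (R / r)) * ∫⁻ ρ in Ioc r R, ENNReal.ofReal ρ⁻¹ * M := by
      refine mul_le_mul_right ?_ _
      exact setLIntegral_mono' measurableSet_Ioc fun ρ hρ =>
        mul_le_mul_right (h ρ (hr.trans hρ.1)) _
    _ = M := by
      rw [lintegral_mul_const' _ _ hM, lintegral_Ioc_inv_eq hr hrR.le,
        ← Real.log_div (hr.trans hrR).ne' hr.ne', ← mul_assoc,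
        ← ENNReal.ofReal_mul (by positivity), one_div_mul_cancel hL.ne']
      simp

lemma lintegral_sub_div_norm_rpow_eq {n : ℕ} {s r R : ℝ} (x xb : Euc n) :
    ∫⁻ y : Euc n, ENNReal.ofReal |logProfile r R ‖x - xb‖ - logProfile r R ‖x + y - xb‖| *
      fracKer n s y = cutoffVariation n s r R (x - xb) := by
  have h := lintegral_add_left_eq_self (μ := volume) (fun z : Euc n =>
    ENNReal.ofReal |logProfile r R ‖x - xb‖ - logProfile r R ‖z‖| * fracKer n s (x - xb - z))
    (x - xb)
  rw [cutoffVariation, ← h]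
  refine lintegral_congr fun y => ?_
  rw [sub_add_cancel_left, add_sub_right_comm]
  simp [fracKer]

lemma lintegral_sub_div_norm_rpow_eq' {n : ℕ} {s r R : ℝ} (x xb : Euc n) :
    ∫⁻ y : Euc n, ENNReal.ofReal |logProfile r R ‖x - xb‖ - logProfile r R ‖x - y - xb‖| *
      fracKer n s y = cutoffVariation n s r R (x - xb) := by
  have h := lintegral_sub_left_eq_self (μ := volume) (fun z : Euc n =>
    ENNReal.ofReal |logProfile r R ‖x - xb‖ - logProfile r R ‖z‖| * fracKer n s (x - xb - z))
    (x - xb)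
  rw [cutoffVariation, ← h]
  refine lintegral_congr fun y => ?_
  rw [sub_sub_cancel, sub_right_comm]

lemma enorm_fracLap_logProfile_le {n : ℕ} {s r R : ℝ} (x xb : Euc n) :
    ‖fracLap n (s / 2) (fun z => logProfile r R ‖z - xb‖) x‖ₑ ≤
      ‖fracC n (s / 2)‖ₑ * cutoffVariation n s r R (x - xb) := by
  have h2 : ‖fracC n (s / 2) / 2‖ₑ * 2 = ‖fracC n (s / 2)‖ₑ := by
    rw [show (2 : ENNReal) = ‖(2 : ℝ)‖ₑ by simp [Real.enorm_eq_ofReal_abs], ← enorm_mul]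
    congr 1
    ring
  rw [fracLap, enorm_mul, ← h2, mul_assoc]
  refine mul_le_mul_right ((enorm_integral_le_lintegral_enorm _).trans ?_) _
  have hm : Measurable fun y : Euc n =>
      ENNReal.ofReal |logProfile r R ‖x - xb‖ - logProfile r R ‖x + y - xb‖| * fracKer n s y := by
    have : Measurable (logProfile r R) := by unfold logProfile; fun_prop
    have := measurable_fracKer n s
    fun_prop
  rw [two_mul (cutoffVariation n s r R (x - xb))]
  nth_rewrite 1 [← lintegral_sub_div_norm_rpow_eq x xb]
  rw [← lintegral_sub_div_norm_rpow_eq' x xb, ← lintegral_add_left hm]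
  refine lintegral_mono fun y => ?_
  rw [← add_mul, fracKer, ← ENNReal.ofReal_add (abs_nonneg _) (abs_nonneg _),
    ← ENNReal.ofReal_mul (by positivity), Real.enorm_eq_ofReal_abs]
  apply ENNReal.ofReal_le_ofReal
  rw [Real.rpow_neg (norm_nonneg _), ← div_eq_mul_inv, abs_div,
    abs_of_nonneg (Real.rpow_nonneg (norm_nonneg y) _), show (n : ℝ) + 2 * (s / 2) = n + s by ring]
  gcongr
  refine le_trans (le_of_eq ?_) (abs_add_le _ _)
  congr 1
  ring

lemma exists_lintegral_cutoffVariation_rpow_le {n : ℕ} {s : ℝ} (hs0 : 0 < s) (hs1 : s < 1)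
    (hn : 2 * s < n) :
    ∃ M : ENNReal, M ≠ ⊤ ∧ ∀ r R : ℝ, 0 < r → r < R →
      ∫⁻ x : Euc n, cutoffVariation n s r R x ^ ((n : ℝ) / s) ≤
        M * ENNReal.ofReal (Real.log (R / r) ^ (1 - (n : ℝ) / s)) := by
  have hn0 : (0 : ℝ) < n := by linarith
  have hn' : 0 < n := by exact_mod_cast hn0
  have : Nonempty (Fin n) := ⟨⟨0, hn'⟩⟩
  have hp : 0 < (n : ℝ) / s - 1 := by
    rw [sub_pos, one_lt_div hs0]
    linarith
  obtain ⟨M1, hM1, h1⟩ := exists_cutoffVariation_le hn' hs0 hs1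
  obtain ⟨M2, hM2, h2⟩ := exists_lintegral_rpow_mul_cutoffVariation_le hn' hs0 hs1
  refine ⟨M1 ^ ((n : ℝ) / s - 1) * M2, by finiteness, fun r R hr hrR => ?_⟩
  have hL : 0 < Real.log (R / r) := Real.log_pos ((one_lt_div hr).2 hrR)
  set c := M1 ^ ((n : ℝ) / s - 1) * ENNReal.ofReal (Real.log (R / r) ^ (1 - (n : ℝ) / s)) with hc
  have hc' : c ≠ ⊤ := by finiteness
  calc
    _ ≤ ∫⁻ x : Euc n, c * (ENNReal.ofReal (‖x‖ ^ (s - n)) * cutoffVariation n s r R x) := by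
      apply lintegral_mono_ae
      have : ∀ᵐ x : Euc n, x ∉ ({0} : Set (Euc n)) := by
        rw [← measure_eq_zero_iff_ae_notMem]
        simp
      filter_upwards [this] with x hx
      have hx : x ≠ 0 := by simpa using hx
      have hx0 : 0 < ‖x‖ := norm_pos_iff.2 hx
      rw [← mul_assoc]
      calc
        _ = cutoffVariation n s r R x ^ ((n : ℝ) / s - 1) * cutoffVariation n s r R x := by
          conv_rhs => enter [2]; rw [← ENNReal.rpow_one (cutoffVariation n s r R x)]
          rw [← ENNReal.rpow_add_of_nonneg _ _ hp.le zero_le_one, sub_add_cancel]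
        _ ≤ (ENNReal.ofReal (‖x‖ ^ (-s)) * (M1 * ENNReal.ofReal (1 / Real.log (R / r)))) ^
              ((n : ℝ) / s - 1) * cutoffVariation n s r R x := by
          gcongr
          exact h1 r R x hr hrR hx
        _ = _ := by
          rw [ENNReal.mul_rpow_of_nonneg _ _ hp.le, ENNReal.mul_rpow_of_nonneg _ _ hp.le,
            ENNReal.ofReal_rpow_of_pos (by positivity), ENNReal.ofReal_rpow_of_pos (by positivity),
            ← Real.rpow_mul hx0.le, one_div, Real.inv_rpow hL.le, ← Real.rpow_neg hL.le, neg_sub,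
            show -s * ((n : ℝ) / s - 1) = s - n by field_simp; ring, hc]
          ring
    _ ≤ _ := by
      rw [lintegral_const_mul' _ _ hc', hc, mul_right_comm]
      gcongr
      exact h2 r R hr hrR


/-- construction of cut-off functions.
For `s ∈ (0,1)`, `n > 2s`, there is `C(n,s) > 0` such that for every `x̄ ∈ ℝⁿ` and radii
`0 < r < R` there is a Lipschitz `φ : ℝⁿ → [0,1]` with `φ ≡ 1` on `B(x̄,r)`, `φ ≡ 0`
outside `B(x̄,R)`, and `∫ |(-Δ)^{s/2} φ|^{n/s} ≤ C (log(R/r))^{1 - n/s}`. -/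
theorem stmt_1 (n : ℕ) (s : ℝ) (hs0 : 0 < s) (hs1 : s < 1) (hn : 2 * s < (n : ℝ)) :
    ∃ C : ℝ, 0 < C ∧
      ∀ (xb : Euc n) (r R : ℝ), 0 < r → r < R →
        ∃ φ : Euc n → ℝ,
          (∃ K : NNReal, LipschitzWith K φ) ∧
          (∀ x, φ x ∈ Set.Icc (0 : ℝ) 1) ∧
          (∀ x ∈ Metric.closedBall xb r, φ x = 1) ∧
          (∀ x ∉ Metric.ball xb R, φ x = 0) ∧
          (∫ x, |fracLap n (s / 2) φ x| ^ ((n : ℝ) / s)) ≤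
            C * Real.log (R / r) ^ (1 - (n : ℝ) / s) := by
  obtain ⟨M, hM, h⟩ := exists_lintegral_cutoffVariation_rpow_le hs0 hs1 hn
  have hp : 0 ≤ (n : ℝ) / s := by positivity
  set N := ‖fracC n (s / 2)‖ₑ ^ ((n : ℝ) / s) * M with hN
  have hN' : N ≠ ⊤ := by finiteness
  refine ⟨N.toReal + 1, by positivity, fun xb r R hr hrR => ?_⟩
  have hL : 0 < Real.log (R / r) := Real.log_pos ((one_lt_div hr).2 hrR)
  refine ⟨fun z => logProfile r R ‖z - xb‖, ?_, fun x => logProfile_mem_Icc hr hrR _,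
    fun x hx => logProfile_of_le hr hrR ?_, fun x hx => logProfile_of_ge hrR ?_, ?_⟩
  · obtain ⟨K, hK⟩ := exists_lipschitzWith_logProfile hr hrR
    exact ⟨K, by
      simpa [Function.comp_def] using hK.comp (lipschitzWith_one_norm.comp
        (LipschitzWith.id.sub (LipschitzWith.const xb)))⟩
  · simpa [dist_eq_norm] using hx
  · simpa [dist_eq_norm] using hx
  · have key : ENNReal.ofReal
        (∫ x, |fracLap n (s / 2) (fun z => logProfile r R ‖z - xb‖) x| ^ ((n : ℝ) / s)) ≤
        N * ENNReal.ofReal (Real.log (R / r) ^ (1 - (n : ℝ) / s)) := by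
      calc
        _ ≤ ∫⁻ x, ‖|fracLap n (s / 2) (fun z => logProfile r R ‖z - xb‖) x| ^ ((n : ℝ) / s)‖ₑ := by
          refine le_trans ?_ (enorm_integral_le_lintegral_enorm _)
          rw [Real.enorm_eq_ofReal_abs]
          exact ENNReal.ofReal_le_ofReal (le_abs_self _)
        _ ≤ ∫⁻ x, ‖fracC n (s / 2)‖ₑ ^ ((n : ℝ) / s) *
              cutoffVariation n s r R (x - xb) ^ ((n : ℝ) / s) := by
          refine lintegral_mono fun x => ?_
          rw [← ENNReal.mul_rpow_of_nonneg _ _ hp, Real.enorm_rpow_of_nonneg (abs_nonneg _) hp,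
            Real.enorm_abs]
          gcongr
          exact enorm_fracLap_logProfile_le x xb
        _ ≤ _ := by
          rw [lintegral_const_mul' _ _ (by finiteness), hN, mul_assoc,
            lintegral_sub_right_eq_self (fun x => cutoffVariation n s r R x ^ ((n : ℝ) / s)) xb]
          gcongr
          exact h r R hr hrR
    rw [← ENNReal.ofReal_toReal hN', ← ENNReal.ofReal_mul ENNReal.toReal_nonneg,
      ENNReal.ofReal_le_ofReal_iff (by positivity)] at key
    refine key.trans ?_
    gcongr
    linarith
end
end

section
/- Let s ∈ (0,1), let n be an integer with n ≥ 6s, and let ν ≥ 2 be an integer. There exist a small constant δ₀ = δ₀(n,s) > 0 and a large constant C = C(n,s) > 0 such that for every δ-interacting family of Talenti bubbles (U_i)_{i=1}^ν with δ < δ₀, the interaction error h = σ^p − Σ_{i=1}^ν U_i^p, where σ = Σ_{i=1}^ν U_i, satisfies ‖h‖_{**} ≤ C, i.e. |σ^p(x) − Σ_{i=1}^ν U_i^p(x)| ≤ C V(x) for all x ∈ ℝⁿ. -/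
open MeasureTheory

noncomputable section

/-- The squared conformal scale `λ / (1 + λ²|x - z|²)` of a bubble at `x`. -/
def bubbleScale {n : ℕ} (z : Euc n) (lam : ℝ) (x : Euc n) : ℝ :=
  lam / (1 + lam ^ 2 * ‖x - z‖ ^ 2)

lemma bubbleScale_pos {n : ℕ} (z : Euc n) {lam : ℝ} (h : 0 < lam) (x : Euc n) :
    0 < bubbleScale z lam x := by
  unfold bubbleScale; positivity

lemma jbr_pos {n : ℕ} (y : Euc n) : 0 < jbr y := by
  unfold jbr; positivity

lemma bubbleScale_eq_div_jbr_sq {n : ℕ} (z : Euc n) (lam : ℝ) (x : Euc n) :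
    bubbleScale z lam x = lam / jbr (lam • (x - z)) ^ 2 := by
  unfold bubbleScale jbr
  rw [Real.sq_sqrt (by positivity), norm_smul, mul_pow, Real.norm_eq_abs, sq_abs]

lemma bubbleScale_le_self {n : ℕ} (z : Euc n) {lam : ℝ} (h : 0 < lam) (x : Euc n) :
    bubbleScale z lam x ≤ lam := by
  unfold bubbleScale
  exact div_le_self h.le (by nlinarith [mul_nonneg (sq_nonneg lam) (sq_nonneg ‖x - z‖)])

lemma bubbleScale_le_div_sq {n : ℕ} (z : Euc n) {lam r : ℝ} (h : 0 < lam) (hr : 0 < r) (x : Euc n)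
    (hx : r ≤ ‖lam • (x - z)‖) : bubbleScale z lam x ≤ lam / r ^ 2 := by
  unfold bubbleScale
  rw [norm_smul, Real.norm_of_nonneg h.le] at hx
  have : r ^ 2 ≤ (lam * ‖x - z‖) ^ 2 := by gcongr
  gcongr
  nlinarith

/-- At any point, one of two bubbles has scale at most `λ' / r²`, where `λ'` is the parameter of the
other bubble and `2r` is at most the separation of the two. -/
lemma bubbleScale_le_or {n : ℕ} (z w : Euc n) {a b r : ℝ} (ha : 0 < a) (hb : 0 < b) (hr : 0 < r)
    (x : Euc n)
    (h : 2 * r ≤ max (√(a / b)) (max (√(b / a)) (√(a * b) * ‖z - w‖))) :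
    bubbleScale w b x ≤ a / r ^ 2 ∨ bubbleScale z a x ≤ b / r ^ 2 := by
  have ratio : ∀ {u v : ℝ}, 0 < u → 0 < v → 2 * r ≤ √(u / v) → v ≤ u / r ^ 2 := by
    intro u v hu hv huv
    have h1 := (Real.le_sqrt' (by positivity)).1 huv
    rw [le_div_iff₀ hv] at h1
    rw [le_div_iff₀ (by positivity)]
    nlinarith [mul_pos (pow_pos hr 2) hv]
  have far : ∀ {u v : ℝ} (y : Euc n), 0 < u → 0 < v → r ^ 2 ≤ u * v * ‖x - y‖ ^ 2 →
      bubbleScale y v x ≤ u / r ^ 2 := by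
    intro u v y hu hv huv
    unfold bubbleScale
    rw [div_le_div_iff₀ (by positivity) (by positivity)]
    nlinarith [mul_le_mul_of_nonneg_left huv hv.le]
  rcases le_max_iff.1 h with h | h
  · exact Or.inl ((bubbleScale_le_self w hb x).trans (ratio ha hb h))
  rcases le_max_iff.1 h with h | h
  · exact Or.inr ((bubbleScale_le_self z ha x).trans (ratio hb ha h))
  have hd : (2 * r) ^ 2 ≤ a * b * ‖z - w‖ ^ 2 := by
    calc (2 * r) ^ 2 ≤ (√(a * b) * ‖z - w‖) ^ 2 := by gcongr
      _ = _ := by rw [mul_pow, Real.sq_sqrt (by positivity)]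
  have htri : ‖z - w‖ ≤ ‖x - z‖ + ‖x - w‖ := by
    simpa [dist_eq_norm] using dist_triangle_left z w x
  rcases le_total ‖x - z‖ ‖x - w‖ with hle | hle
  · refine Or.inl (far w ha hb ?_)
    have : ‖z - w‖ ^ 2 ≤ (2 * ‖x - w‖) ^ 2 := by gcongr; linarith
    nlinarith [mul_le_mul_of_nonneg_left this (mul_pos ha hb).le]
  · refine Or.inr (far z hb ha ?_)
    have : ‖z - w‖ ^ 2 ≤ (2 * ‖x - z‖) ^ 2 := by gcongr; linarith
    nlinarith [mul_le_mul_of_nonneg_left this (mul_pos ha hb).le]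

lemma one_le_Rij (n : ℕ) {ν : ℕ} (z : Fin ν → Euc n) {lam : Fin ν → ℝ} (h : ∀ i, 0 < lam i)
    (i j : Fin ν) : 1 ≤ Rij n z lam i j := by
  unfold Rij
  rcases le_total (lam j) (lam i) with hle | hle
  · exact le_max_of_le_left (Real.one_le_sqrt.2 ((one_le_div (h j)).2 hle))
  · exact le_max_of_le_right (le_max_of_le_left (Real.one_le_sqrt.2 ((one_le_div (h i)).2 hle)))

lemma Rmin_pos (n : ℕ) {ν : ℕ} (hν : 2 ≤ ν) (z : Fin ν → Euc n) {lam : Fin ν → ℝ}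
    (h : ∀ i, 0 < lam i) : 0 < Rmin n z lam := by
  have : 1 ≤ sInf {r : ℝ | ∃ i j, i ≠ j ∧ r = Rij n z lam i j} := by
    refine le_csInf ⟨_, ⟨0, by omega⟩, ⟨1, by omega⟩, by simp, rfl⟩ ?_
    rintro _ ⟨i, j, -, rfl⟩
    exact one_le_Rij n z h i j
  unfold Rmin
  linarith

lemma two_mul_Rmin_le_Rij (n : ℕ) {ν : ℕ} (z : Fin ν → Euc n) {lam : Fin ν → ℝ}
    (h : ∀ i, 0 < lam i) {i j : Fin ν} (hij : i ≠ j) : 2 * Rmin n z lam ≤ Rij n z lam i j := by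
  have : sInf {r : ℝ | ∃ i j, i ≠ j ∧ r = Rij n z lam i j} ≤ Rij n z lam i j := by
    refine csInf_le ⟨1, ?_⟩ ⟨i, j, hij, rfl⟩
    rintro _ ⟨i, j, -, rfl⟩
    exact one_le_Rij n z h i j
  unfold Rmin
  linarith

lemma rpow_add_mul_rpow_mul_rpow {a r t : ℝ} (ha : 0 < a) (hr : 0 < r) (ht : 0 < t) (k l : ℝ) :
    a ^ (k + l) * r ^ (-(2 * l)) * t ^ (-(2 * k)) = (a / t ^ 2) ^ k * (a / r ^ 2) ^ l := by
  rw [Real.div_rpow ha.le (by positivity), Real.div_rpow ha.le (by positivity),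
    Real.rpow_add ha, Real.rpow_neg hr.le, Real.rpow_neg ht.le, ← Real.rpow_natCast_mul ht.le,
    ← Real.rpow_natCast_mul hr.le]
  push_cast
  field_simp

lemma le_Vwt_of_le_summand (n : ℕ) (s : ℝ) {ν : ℕ} (z : Fin ν → Euc n) {lam : Fin ν → ℝ}
    (h : ∀ i, 0 < lam i) (hR : 0 < Rmin n z lam) (x : Euc n) (i : Fin ν) :
    (bubbleScale (z i) (lam i) x ^ (2 * s) *
          (lam i / Rmin n z lam ^ 2) ^ (((n : ℝ) - 2 * s) / 2) *
          (if ‖lam i • (x - z i)‖ ≤ Rmin n z lam then (1 : ℝ) else 0) +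
        bubbleScale (z i) (lam i) x ^ (((n : ℝ) - 2 * s) / 2) *
          (lam i / Rmin n z lam ^ 2) ^ (2 * s) *
          (if Rmin n z lam / 2 ≤ ‖lam i • (x - z i)‖ then (1 : ℝ) else 0)) ≤ Vwt n s z lam x := by
  have key : ∀ i, _ = _ := fun i =>
    rpow_add_mul_rpow_mul_rpow (h i) hR (jbr_pos (lam i • (x - z i))) (2 * s)
      (((n : ℝ) - 2 * s) / 2)
  have key' : ∀ i, _ = _ := fun i =>
    rpow_add_mul_rpow_mul_rpow (h i) hR (jbr_pos (lam i • (x - z i)))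
      (((n : ℝ) - 2 * s) / 2) (2 * s)
  rw [bubbleScale_eq_div_jbr_sq, ← key, ← key']
  have e1 : 2 * s + ((n : ℝ) - 2 * s) / 2 = ((n : ℝ) + 2 * s) / 2 := by ring
  have e2 : ((n : ℝ) - 2 * s) / 2 + 2 * s = ((n : ℝ) + 2 * s) / 2 := by ring
  have e3 : -(2 * (((n : ℝ) - 2 * s) / 2)) = 2 * s - n := by ring
  have e4 : -(2 * (2 * s)) = -(4 * s) := by ring
  rw [e1, e2, e3, e4]
  refine Finset.single_le_sum (f := fun i =>
      (lam i ^ (((n : ℝ) + 2 * s) / 2) * Rmin n z lam ^ (2 * s - (n : ℝ)) *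
          jbr (lam i • (x - z i)) ^ (-(4 * s)) *
          (if ‖lam i • (x - z i)‖ ≤ Rmin n z lam then (1 : ℝ) else 0) +
        lam i ^ (((n : ℝ) + 2 * s) / 2) * Rmin n z lam ^ (-(4 * s)) *
          jbr (lam i • (x - z i)) ^ (2 * s - (n : ℝ)) *
          (if Rmin n z lam / 2 ≤ ‖lam i • (x - z i)‖ then (1 : ℝ) else 0))) ?_ (Finset.mem_univ i)
  intro i _
  have := h i
  have := jbr_pos (lam i • (x - z i))
  positivity

lemma inner_le_Vwt (n : ℕ) (s : ℝ) {ν : ℕ} (z : Fin ν → Euc n) {lam : Fin ν → ℝ}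
    (h : ∀ i, 0 < lam i) (hR : 0 < Rmin n z lam) (x : Euc n) (i : Fin ν)
    (hi : ‖lam i • (x - z i)‖ ≤ Rmin n z lam) :
    bubbleScale (z i) (lam i) x ^ (2 * s) *
      (lam i / Rmin n z lam ^ 2) ^ (((n : ℝ) - 2 * s) / 2) ≤ Vwt n s z lam x := by
  refine le_trans ?_ (le_Vwt_of_le_summand n s z h hR x i)
  rw [if_pos hi, mul_one]
  have := h i
  have := bubbleScale_pos (z i) (h i) x
  exact le_add_of_nonneg_right (by positivity)

lemma outer_le_Vwt (n : ℕ) (s : ℝ) {ν : ℕ} (z : Fin ν → Euc n) {lam : Fin ν → ℝ}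
    (h : ∀ i, 0 < lam i) (hR : 0 < Rmin n z lam) (x : Euc n) (i : Fin ν)
    (hi : Rmin n z lam ≤ ‖lam i • (x - z i)‖) :
    bubbleScale (z i) (lam i) x ^ (((n : ℝ) - 2 * s) / 2) *
      (lam i / Rmin n z lam ^ 2) ^ (2 * s) ≤ Vwt n s z lam x := by
  refine le_trans ?_ (le_Vwt_of_le_summand n s z h hR x i)
  rw [if_pos (show Rmin n z lam / 2 ≤ ‖lam i • (x - z i)‖ by linarith), mul_one]
  have := h i
  have := bubbleScale_pos (z i) (h i) x
  exact le_add_of_nonneg_left (by positivity)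

lemma rpow_mul_rpow_le_swap {a b k l : ℝ} (hb : 0 < b) (hba : b ≤ a) (hkl : k ≤ l) :
    a ^ k * b ^ l ≤ a ^ l * b ^ k := by
  have ha : 0 < a := hb.trans_le hba
  calc a ^ k * b ^ l = a ^ k * (b ^ k * b ^ (l - k)) := by
        rw [← Real.rpow_add hb, add_sub_cancel]
    _ ≤ a ^ k * (b ^ k * a ^ (l - k)) := by
        gcongr
    _ = (a ^ k * a ^ (l - k)) * b ^ k := by ring
    _ = a ^ l * b ^ k := by rw [← Real.rpow_add ha, add_sub_cancel]

/-- The mixed product of two bubbles, the larger one raised to the power `p - 1`, is controlled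
by `V`. -/
lemma bubbleScale_mul_le_Vwt (n : ℕ) {s : ℝ} (hs : 0 < s) (hn : 6 * s ≤ (n : ℝ)) {ν : ℕ}
    (z : Fin ν → Euc n) {lam : Fin ν → ℝ} (h : ∀ i, 0 < lam i) (hR : 0 < Rmin n z lam)
    (x : Euc n) {i j : Fin ν} (hij : i ≠ j)
    (hle : bubbleScale (z j) (lam j) x ≤ bubbleScale (z i) (lam i) x) :
    bubbleScale (z i) (lam i) x ^ (2 * s) *
      bubbleScale (z j) (lam j) x ^ (((n : ℝ) - 2 * s) / 2) ≤ Vwt n s z lam x := by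
  have hA := bubbleScale_pos (z i) (h i) x
  have hB := bubbleScale_pos (z j) (h j) x
  have hkl : 2 * s ≤ ((n : ℝ) - 2 * s) / 2 := by linarith
  have hm : 0 ≤ ((n : ℝ) - 2 * s) / 2 := by linarith
  have swap := rpow_mul_rpow_le_swap hB hle hkl
  rcases bubbleScale_le_or (z i) (z j) (h i) (h j) hR x (two_mul_Rmin_le_Rij n z h hij) with h1 | h1
  · rcases le_total ‖lam i • (x - z i)‖ (Rmin n z lam) with hi | hi
    · refine le_trans ?_ (inner_le_Vwt n s z h hR x i hi)
      gcongr
    · refine swap.trans (le_trans ?_ (outer_le_Vwt n s z h hR x i hi))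
      gcongr
  · rcases le_total ‖lam j • (x - z j)‖ (Rmin n z lam) with hj | hj
    · refine swap.trans (le_trans ?_ (inner_le_Vwt n s z h hR x j hj))
      rw [mul_comm]
      gcongr
    · refine le_trans ?_ (outer_le_Vwt n s z h hR x j hj)
      rw [mul_comm]
      gcongr

lemma sum_rpow_le_rpow_sum {ι : Type*} [Fintype ι] {u : ι → ℝ} (hu : ∀ i, 0 < u i) {p : ℝ}
    (hp : 1 ≤ p) : ∑ i, u i ^ p ≤ (∑ i, u i) ^ p := by
  rcases isEmpty_or_nonempty ι with hι | hι
  · simp [Real.zero_rpow (by linarith : p ≠ 0)]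
  have hσ : 0 < ∑ i, u i := Finset.sum_pos (fun i _ => hu i) Finset.univ_nonempty
  calc ∑ i, u i ^ p = ∑ i, u i ^ (p - 1) * u i := by
        refine Finset.sum_congr rfl fun i _ => ?_
        rw [← Real.rpow_add_one (hu i).ne', sub_add_cancel]
    _ ≤ ∑ i, (∑ k, u k) ^ (p - 1) * u i := by
        refine Finset.sum_le_sum fun i _ => ?_
        have := hu i
        have : u i ≤ ∑ k, u k :=
          Finset.single_le_sum (fun k _ => (hu k).le) (Finset.mem_univ i)
        have : 0 ≤ p - 1 := by linarith
        gcongr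
    _ = (∑ i, u i) ^ p := by
        rw [← Finset.mul_sum, ← Real.rpow_add_one hσ.ne', sub_add_cancel]

lemma rpow_sub_rpow_le_mul {a b p : ℝ} (ha : 0 ≤ a) (hb : 0 < b) (hp : 1 ≤ p) :
    b ^ p - a ^ p ≤ p * b ^ (p - 1) * (b - a) := by
  have h := one_add_mul_self_le_rpow_one_add (s := a / b - 1) (by linarith [div_nonneg ha hb.le]) hp
  rw [add_sub_cancel, Real.div_rpow ha hb.le, le_div_iff₀ (by positivity)] at h
  have e : b ^ p = b ^ (p - 1) * b := by rw [← Real.rpow_add_one hb.ne', sub_add_cancel]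
  have e2 : b ^ p * (a / b) = b ^ (p - 1) * a := by rw [e]; field_simp
  nlinarith

/-- The defect of additivity of `t ↦ t ^ p` is controlled by the cross terms with a largest
summand. -/
lemma abs_rpow_sum_sub_sum_rpow_le {ι : Type*} [Fintype ι] [DecidableEq ι] {u : ι → ℝ}
    (hu : ∀ i, 0 < u i) {p : ℝ} (hp : 1 ≤ p) (i : ι) (hi : ∀ j, u j ≤ u i) :
    |(∑ j, u j) ^ p - ∑ j, u j ^ p| ≤
      p * (Fintype.card ι : ℝ) ^ (p - 1) * ∑ j ∈ Finset.univ.erase i, u i ^ (p - 1) * u j := by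
  have hp1 : 0 ≤ p - 1 := by linarith
  have hσ : 0 < ∑ j, u j := Finset.sum_pos (fun j _ => hu j) ⟨i, Finset.mem_univ i⟩
  have hσle : ∑ j, u j ≤ Fintype.card ι * u i := by
    simpa using Finset.sum_le_card_nsmul Finset.univ u (u i) fun j _ => hi j
  have hrest : ∑ j, u j - u i = ∑ j ∈ Finset.univ.erase i, u j := by
    rw [← Finset.add_sum_erase _ u (Finset.mem_univ i), add_sub_cancel_left]
  have hrest0 : 0 ≤ ∑ j ∈ Finset.univ.erase i, u j := Finset.sum_nonneg fun j _ => (hu j).le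
  rw [abs_of_nonneg (sub_nonneg.2 (sum_rpow_le_rpow_sum hu hp))]
  calc (∑ j, u j) ^ p - ∑ j, u j ^ p ≤ (∑ j, u j) ^ p - u i ^ p := by
        gcongr
        exact Finset.single_le_sum (f := fun j => u j ^ p)
          (fun j _ => Real.rpow_nonneg (hu j).le p) (Finset.mem_univ i)
    _ ≤ p * (∑ j, u j) ^ (p - 1) * (∑ j, u j - u i) := rpow_sub_rpow_le_mul (hu i).le hσ hp
    _ ≤ p * (Fintype.card ι * u i) ^ (p - 1) * (∑ j, u j - u i) := by
        rw [hrest]; gcongr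
    _ = _ := by
        rw [hrest, Real.mul_rpow (by positivity) (hu i).le, ← Finset.mul_sum]; ring

/-- bound on the interaction error `h = σ^p - Σ U_i^p`.
For `n ≥ 6s`, `ν ≥ 2`, there are `δ₀, C > 0` such that for any `δ`-interacting family
with `δ < δ₀`, `|σ^p(x) - Σ_i U_i^p(x)| ≤ C V(x)` for all `x`. -/
theorem stmt_8 (n ν : ℕ) (s cns : ℝ) (hs0 : 0 < s) (hs1 : s < 1)
    (hn : 6 * s ≤ (n : ℝ)) (hν : 2 ≤ ν) (hc : 0 < cns) :
    ∃ δ₀ : ℝ, 0 < δ₀ ∧ ∃ C : ℝ, 0 < C ∧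
      ∀ (δ : ℝ) (z : Fin ν → Euc n) (lam : Fin ν → ℝ),
        0 < δ → δ < δ₀ →
        DeltaInteracting n z lam δ →
        ∀ x : Euc n,
          |(∑ i, bubble n cns s (z i) (lam i) x) ^ pexp n s -
              ∑ i, bubble n cns s (z i) (lam i) x ^ pexp n s| ≤
            C * Vwt n s z lam x := by
  have hm : 0 < (n : ℝ) - 2 * s := by linarith
  have hp : 1 ≤ pexp n s := by
    rw [pexp, one_le_div hm]; linarith
  have hp0 : 0 < pexp n s := by linarith
  have hexp : ((n : ℝ) - 2 * s) / 2 * (pexp n s - 1) = 2 * s := by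
    unfold pexp; field_simp; ring
  have hν0 : (0 : ℝ) < ν := by exact_mod_cast (by omega : 0 < ν)
  refine ⟨1, one_pos, pexp n s * (ν : ℝ) ^ (pexp n s - 1) * (ν * cns ^ pexp n s), by positivity, ?_⟩
  intro δ z lam _ _ hδ x
  have hlam := hδ.1
  have hR := Rmin_pos n hν z hlam
  have hU : ∀ i, bubble n cns s (z i) (lam i) x =
      cns * bubbleScale (z i) (lam i) x ^ (((n : ℝ) - 2 * s) / 2) := fun i => rfl
  have hscale := fun i => bubbleScale_pos (z i) (hlam i) x
  have hpos : ∀ i, 0 < bubble n cns s (z i) (lam i) x := fun i => by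
    have := hscale i
    rw [hU]; positivity
  have : Nonempty (Fin ν) := ⟨⟨0, by omega⟩⟩
  obtain ⟨i, hi⟩ := Finite.exists_max fun i => bubbleScale (z i) (lam i) x
  have hV : 0 ≤ Vwt n s z lam x := by
    have := hlam i
    have := hscale i
    exact le_trans (by positivity) (le_Vwt_of_le_summand n s z hlam hR x i)
  refine (abs_rpow_sum_sub_sum_rpow_le hpos hp i fun j => ?_).trans ?_
  · have := hscale j
    rw [hU, hU]
    gcongr
    exact hi j
  rw [Fintype.card_fin, mul_assoc _ _ (Vwt n s z lam x)]
  refine mul_le_mul_of_nonneg_left ?_ (by positivity)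
  calc _ ≤ ∑ j ∈ Finset.univ.erase i, cns ^ pexp n s * Vwt n s z lam x := by
        refine Finset.sum_le_sum fun j hj => ?_
        have hA := hscale i
        calc _ = cns ^ pexp n s * (bubbleScale (z i) (lam i) x ^ (2 * s) *
              bubbleScale (z j) (lam j) x ^ (((n : ℝ) - 2 * s) / 2)) := by
              rw [hU, hU, Real.mul_rpow hc.le (by positivity), ← Real.rpow_mul hA.le, hexp,
                Real.rpow_sub_one hc.ne']
              field_simp
          _ ≤ _ := by
              gcongr
              exact bubbleScale_mul_le_Vwt n hs0 hn z hlam hR x (Finset.ne_of_mem_erase hj).symm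
                (hi j)
    _ ≤ ∑ _j : Fin ν, cns ^ pexp n s * Vwt n s z lam x :=
        Finset.sum_le_sum_of_subset_of_nonneg (Finset.erase_subset _ _) fun _ _ _ => by positivity
    _ = _ := by simp; ring
end
end

section
/- Let s ∈ (0,1) and let n be an integer with n > 4s. Then there exists a constant α_{n,s} > 0 such that for all x ∈ ℝⁿ, (−Δ)^s [ (1+|·|²)^{−s} ](x) ≥ α_{n,s} (1+|x|²)^{−2s}. -/
open MeasureTheory

noncomputable section

/-- The graph of `z ↦ z ^ (-s)` lies above its tangent lines. -/
theorem rpow_neg_tangent_le {s A p : ℝ} (hs0 : 0 < s) (hs1 : s < 1) (hA : 0 < A) (hp : 0 < p) :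
    A ^ (-s) * (1 - s * ((p - A) / A)) ≤ p ^ (-s) := by
  have hfac : p ^ (-s) = A ^ (-s) * ((p / A) ^ s)⁻¹ := by
    rw [Real.div_rpow hp.le hA.le, Real.rpow_neg hA.le, Real.rpow_neg hp.le]
    have := (Real.rpow_pos_of_pos hA s).ne'
    field_simp
  have hq : (p / A) ^ s ≤ 1 + s * (p / A - 1) := by
    have := rpow_one_add_le_one_add_mul_self (s := p / A - 1)
      (by have := div_pos hp hA; linarith) hs0.le hs1.le
    simpa using this
  have h0 : 0 < (p / A) ^ s := by positivity
  have hinv : 2 - (p / A) ^ s ≤ ((p / A) ^ s)⁻¹ := by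
    rw [inv_eq_one_div, le_div_iff₀ h0]
    nlinarith [sq_nonneg ((p / A) ^ s - 1)]
  have e : p / A - 1 = (p - A) / A := by field_simp
  rw [e] at hq
  rw [hfac]
  gcongr
  linarith

theorem rpow_neg_add_rpow_neg_le {s a b c d : ℝ} (hs0 : 0 < s) (hs1 : s < 1) (ha : 0 < a)
    (hac : a ≤ c) (had : a ≤ d) (h : a + b = c + d) :
    c ^ (-s) + d ^ (-s) ≤ a ^ (-s) + b ^ (-s) := by
  wlog hcd : c ≤ d generalizing c d
  · linarith [this had hac (by linarith) (by linarith)]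
  have hc : 0 < c := by linarith
  have hd : 0 < d := by linarith
  have h1 := rpow_neg_tangent_le hs0 hs1 hc ha
  have h2 := rpow_neg_tangent_le hs0 hs1 hd (show 0 < b by linarith)
  have h3 : d ^ (-s) / d ≤ c ^ (-s) / c :=
    div_le_div₀ (by positivity) (Real.rpow_le_rpow_of_nonpos hc hcd (by linarith)) hc hcd
  have h4 := mul_le_mul_of_nonneg_left h3 (mul_nonneg hs0.le (sub_nonneg.2 hac))
  have e1 : c ^ (-s) * (1 - s * ((a - c) / c)) =
    c ^ (-s) + s * (c - a) * (c ^ (-s) / c) := by ring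
  have e2 : d ^ (-s) * (1 - s * ((b - d) / d)) =
    d ^ (-s) - s * (c - a) * (d ^ (-s) / d) := by rw [show b - d = c - a by linarith]; ring
  linarith

theorem bracket_sub_le_inversion {s R r : ℝ} (hs0 : 0 < s) (hs1 : s < 1) (hr : 0 < r) (hrR : r ≤ R) :
    (1 + r ^ 2) ^ (-s) - (1 + R ^ 2) ^ (-s) ≤
      (R / r) ^ (2 * s) * ((1 + R ^ 2) ^ (-s) - (1 + (R ^ 2 / r) ^ 2) ^ (-s)) := by
  have hR : 0 < R := hr.trans_le hrR
  have key : ∀ z : ℝ, 0 < z → (R / r) ^ (2 * s) * z ^ (-s) = ((r / R) ^ 2 * z) ^ (-s) := by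
    intro z hz
    rw [Real.mul_rpow (by positivity) hz.le, ← Real.rpow_natCast, ← Real.rpow_mul (by positivity),
      ← inv_div R r, Real.inv_rpow (by positivity), ← Real.rpow_neg (by positivity)]
    congr 2
    push_cast; ring
  rw [mul_sub, key _ (by positivity), key _ (by positivity)]
  have ht : (r / R) ^ 2 ≤ 1 := by
    rw [div_pow, div_le_one (by positivity)]; gcongr
  have ht0 : 0 < (r / R) ^ 2 := by positivity
  have hr2 : r ^ 2 = (r / R) ^ 2 * R ^ 2 := by field_simp
  have e : (r / R) ^ 2 * (1 + (R ^ 2 / r) ^ 2) = (r / R) ^ 2 + R ^ 2 := by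
    field_simp
  have := rpow_neg_add_rpow_neg_le (s := s) (a := (r / R) ^ 2 * (1 + R ^ 2)) (b := 1 + R ^ 2)
    (c := 1 + r ^ 2) (d := (r / R) ^ 2 + R ^ 2) hs0 hs1 (by positivity)
    (by rw [hr2]; linarith) (by nlinarith [sq_nonneg R]) (by rw [hr2]; ring)
  rw [e]
  linarith

theorem abs_rpow_neg_sub_taylor_le {s A p : ℝ} (hs0 : 0 < s) (hs1 : s < 1) (hA : 1 ≤ A)
    (hp : 1 ≤ p) :
    |A ^ (-s) - p ^ (-s) - A ^ (-s) * (s * ((p - A) / A))| ≤ s * (p - A) ^ 2 := by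
  have hA0 : 0 < A := by linarith
  have hp0 : 0 < p := by linarith
  have hAs : A ^ (-s) ≤ 1 := Real.rpow_le_one_of_one_le_of_nonpos hA (by linarith)
  have hAs0 : 0 < A ^ (-s) := Real.rpow_pos_of_pos hA0 _
  have hfac : p ^ (-s) = A ^ (-s) * (A / p) ^ s := by
    rw [Real.div_rpow hA0.le hp0.le, Real.rpow_neg hA0.le, Real.rpow_neg hp0.le]
    have := (Real.rpow_pos_of_pos hA0 s).ne'
    field_simp
  have hup : (A / p) ^ s ≤ 1 + s * (A / p - 1) := by
    have := rpow_one_add_le_one_add_mul_self (s := A / p - 1)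
      (by have := div_pos hA0 hp0; linarith) hs0.le hs1.le
    simpa using this
  have hlow : 1 - s * (p / A - 1) ≤ (A / p) ^ s := by
    have := rpow_neg_tangent_le hs0 hs1 hA0 hp0
    rw [hfac, mul_le_mul_iff_right₀ hAs0] at this
    rwa [show p / A - 1 = (p - A) / A by field_simp]
  have e : A / p - 1 = - ((p - A) / A) + (p - A) ^ 2 / (p * A) := by field_simp; ring
  have e' : p / A - 1 = (p - A) / A := by field_simp
  have hb : (p - A) ^ 2 / (p * A) ≤ (p - A) ^ 2 :=
    div_le_self (sq_nonneg _) (by nlinarith)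
  rw [e] at hup
  rw [e'] at hlow
  rw [hfac, show A ^ (-s) - A ^ (-s) * (A / p) ^ s - A ^ (-s) * (s * ((p - A) / A)) =
    - (A ^ (-s) * ((A / p) ^ s - (1 - s * ((p - A) / A)))) by ring, abs_neg,
    abs_of_nonneg (mul_nonneg hAs0.le (by linarith))]
  have : (A / p) ^ s - (1 - s * ((p - A) / A)) ≤ s * (p - A) ^ 2 := by
    nlinarith
  calc _ ≤ 1 * ((A / p) ^ s - (1 - s * ((p - A) / A))) := by gcongr
    _ ≤ _ := by linarith

/-- The profile `(1 + |x|²)^{-s}`. -/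
def bracketPow (n : ℕ) (s : ℝ) (x : Euc n) : ℝ := (1 + ‖x‖ ^ 2) ^ (-s)

theorem bracketPow_pos (n : ℕ) (s : ℝ) (x : Euc n) : 0 < bracketPow n s x := by
  unfold bracketPow; positivity

theorem bracketPow_le_one (n : ℕ) {s : ℝ} (hs : 0 < s) (x : Euc n) : bracketPow n s x ≤ 1 :=
  Real.rpow_le_one_of_one_le_of_nonpos (by nlinarith [sq_nonneg ‖x‖]) (by linarith)

theorem bracketPow_anti (n : ℕ) {s : ℝ} (hs : 0 < s) {x y : Euc n} (h : ‖x‖ ≤ ‖y‖) :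
    bracketPow n s y ≤ bracketPow n s x :=
  Real.rpow_le_rpow_of_nonpos (by positivity) (by gcongr) (by linarith)

@[fun_prop]
theorem continuous_bracketPow (n : ℕ) (s : ℝ) : Continuous (bracketPow n s) := by
  unfold bracketPow
  exact Continuous.rpow_const (by fun_prop) fun x => Or.inl (by positivity)

theorem abs_second_difference_bracketPow_le (n : ℕ) {s : ℝ} (hs0 : 0 < s) (hs1 : s < 1)
    (x y : Euc n) :
    |2 * bracketPow n s x - bracketPow n s (x + y) - bracketPow n s (x - y)| ≤
      (2 + 2 * s + 2 * s * (1 + 2 * ‖x‖) ^ 2) * min 1 (‖y‖ ^ 2) := by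
  rcases le_total 1 (‖y‖ ^ 2) with hy | hy
  · rw [min_eq_left hy, abs_le]
    have h1 := bracketPow_pos n s x
    have h2 := bracketPow_pos n s (x + y)
    have h3 := bracketPow_pos n s (x - y)
    have h1' := bracketPow_le_one n hs0 x
    have h2' := bracketPow_le_one n hs0 (x + y)
    have h3' := bracketPow_le_one n hs0 (x - y)
    have : 0 ≤ s * (1 + 2 * ‖x‖) ^ 2 := by positivity
    constructor <;> linarith
  · rw [min_eq_right hy]
    have hy1 : ‖y‖ ≤ 1 := by
      rw [← one_pow 2] at hy
      exact (sq_le_sq₀ (norm_nonneg _) zero_le_one).1 hy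
    set A := 1 + ‖x‖ ^ 2 with hAdef
    set p := 1 + ‖x + y‖ ^ 2 with hp
    set q := 1 + ‖x - y‖ ^ 2 with hq
    have hA : 1 ≤ A := by nlinarith [sq_nonneg ‖x‖]
    have hp1 : 1 ≤ p := by nlinarith [sq_nonneg ‖x + y‖]
    have hq1 : 1 ≤ q := by nlinarith [sq_nonneg ‖x - y‖]
    have ep : p - A = ‖y‖ ^ 2 + 2 * inner ℝ x y := by
      rw [hp, hAdef, norm_add_sq_real]; ring
    have eq : q - A = ‖y‖ ^ 2 - 2 * inner ℝ x y := by
      rw [hq, hAdef, norm_sub_sq_real]; ring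
    have hin := abs_le.1 (abs_real_inner_le_norm x y)
    have hyy : ‖y‖ ^ 2 ≤ ‖y‖ := by nlinarith [norm_nonneg y]
    have bp : (p - A) ^ 2 ≤ (1 + 2 * ‖x‖) ^ 2 * ‖y‖ ^ 2 := by
      rw [ep, ← mul_pow]
      apply sq_le_sq'
      · nlinarith [sq_nonneg ‖y‖, norm_nonneg y]
      · nlinarith
    have bq : (q - A) ^ 2 ≤ (1 + 2 * ‖x‖) ^ 2 * ‖y‖ ^ 2 := by
      rw [eq, ← mul_pow]
      apply sq_le_sq'
      · nlinarith [sq_nonneg ‖y‖, norm_nonneg y]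
      · nlinarith
    have tp := abs_le.1 (abs_rpow_neg_sub_taylor_le hs0 hs1 hA hp1)
    have tq := abs_le.1 (abs_rpow_neg_sub_taylor_le hs0 hs1 hA hq1)
    have hAs : A ^ (-s) ≤ 1 := Real.rpow_le_one_of_one_le_of_nonpos hA (by linarith)
    have hAs0 : 0 < A ^ (-s) := Real.rpow_pos_of_pos (by linarith) _
    have elin : A ^ (-s) * (s * ((p - A) / A)) + A ^ (-s) * (s * ((q - A) / A)) =
        A ^ (-s) * (2 * s * (‖y‖ ^ 2 / A)) := by
      rw [ep, eq]; ring
    have hlin0 : 0 ≤ A ^ (-s) * (2 * s * (‖y‖ ^ 2 / A)) := by positivity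
    have hlin1 : A ^ (-s) * (2 * s * (‖y‖ ^ 2 / A)) ≤ 1 * (2 * s * ‖y‖ ^ 2) := by
      gcongr
      exact div_le_self (by positivity) hA
    have sp := mul_le_mul_of_nonneg_left bp hs0.le
    have sq := mul_le_mul_of_nonneg_left bq hs0.le
    have hy0 := sq_nonneg ‖y‖
    have hsy : 0 ≤ s * ‖y‖ ^ 2 := by positivity
    change |2 * A ^ (-s) - p ^ (-s) - q ^ (-s)| ≤ _
    rw [abs_le]
    constructor <;> nlinarith

theorem integrable_min_div_norm_rpow {n : ℕ} (hn : 0 < n) {s : ℝ} (hs0 : 0 < s) (hs1 : s < 1) :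
    Integrable fun y : Euc n => min 1 (‖y‖ ^ 2) / ‖y‖ ^ ((n : ℝ) + 2 * s) := by
  have : Nonempty (Fin n) := ⟨⟨0, hn⟩⟩
  rw [integrable_fun_norm_addHaar volume (E := Euc n)
    (f := fun r : ℝ => min 1 (r ^ 2) / r ^ ((n : ℝ) + 2 * s)), finrank_euclideanSpace_fin]
  have hpow : ∀ r : ℝ, 0 < r → r ^ (n - 1) = r ^ ((n : ℝ) - 1) := by
    intro r hr
    rw [← Real.rpow_natCast, Nat.cast_sub hn, Nat.cast_one]
  rw [← Set.Ioc_union_Ioi_eq_Ioi (zero_le_one' ℝ)]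
  refine IntegrableOn.union ?_ ?_
  · have : IntegrableOn (fun r : ℝ => r ^ (1 - 2 * s)) (Set.Ioc 0 1) := by
      rw [← intervalIntegrable_iff_integrableOn_Ioc_of_le zero_le_one]
      exact intervalIntegral.intervalIntegrable_rpow' (by linarith)
    refine this.congr_fun (fun r hr => ?_) measurableSet_Ioc
    have hr0 : 0 < r := hr.1
    simp only [smul_eq_mul]
    rw [min_eq_right (by nlinarith [hr.2]), hpow r hr0, ← Real.rpow_natCast r 2,
      ← Real.rpow_sub hr0, ← Real.rpow_add hr0]
    congr 1
    push_cast; ring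
  · have : IntegrableOn (fun r : ℝ => r ^ (-1 - 2 * s)) (Set.Ioi 1) :=
      integrableOn_Ioi_rpow_of_lt (by linarith) zero_lt_one
    refine this.congr_fun (fun r hr => ?_) measurableSet_Ioi
    have hr1 : 1 < r := hr
    have hr0 : 0 < r := by linarith
    simp only [smul_eq_mul]
    rw [min_eq_left (by nlinarith), hpow r hr0, ← Real.rpow_zero r,
      ← Real.rpow_sub hr0, ← Real.rpow_add hr0]
    congr 1
    ring

theorem integrable_second_difference_bracketPow {n : ℕ} (hn : 0 < n) {s : ℝ} (hs0 : 0 < s)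
    (hs1 : s < 1) (x : Euc n) :
    Integrable fun y : Euc n =>
      (2 * bracketPow n s x - bracketPow n s (x + y) - bracketPow n s (x - y)) /
        ‖y‖ ^ ((n : ℝ) + 2 * s) := by
  refine ((integrable_min_div_norm_rpow hn hs0 hs1).const_mul
    (2 + 2 * s + 2 * s * (1 + 2 * ‖x‖) ^ 2)).mono' ?_ (Filter.Eventually.of_forall fun y => ?_)
  · refine Measurable.aestronglyMeasurable ?_
    have := (continuous_bracketPow n s).measurable
    fun_prop
  · rw [Real.norm_eq_abs, abs_div, abs_of_nonneg (Real.rpow_nonneg (norm_nonneg y) _), mul_div]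
    gcongr
    exact abs_second_difference_bracketPow_le n hs0 hs1 x y

theorem integrableOn_difference_bracketPow {n : ℕ} (hn : 0 < n) {s ε : ℝ} (hs0 : 0 < s)
    (hs1 : s < 1) (hε : 0 < ε) (x : Euc n) :
    IntegrableOn (fun z : Euc n =>
      (bracketPow n s x - bracketPow n s z) / ‖z - x‖ ^ ((n : ℝ) + 2 * s))
      {z | ε < ‖z - x‖} := by
  have hm : MeasurableSet {z : Euc n | ε < ‖z - x‖} :=
    measurableSet_lt (by fun_prop) (by fun_prop)
  have hi := ((integrable_min_div_norm_rpow hn hs0 hs1).comp_sub_right x).const_mul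
    (min 1 (ε ^ 2))⁻¹
  refine hi.integrableOn.mono' ?_ ((ae_restrict_iff' hm).2 (Filter.Eventually.of_forall ?_))
  · refine Measurable.aestronglyMeasurable ?_
    have := (continuous_bracketPow n s).measurable
    fun_prop
  · intro z hz
    have hz : ε < ‖z - x‖ := hz
    have h1 := bracketPow_pos n s x
    have h2 := bracketPow_pos n s z
    have h1' := bracketPow_le_one n hs0 x
    have h2' := bracketPow_le_one n hs0 z
    have hmin : 0 < min 1 (ε ^ 2) := lt_min one_pos (by positivity)
    rw [Real.norm_eq_abs, abs_div, abs_of_nonneg (Real.rpow_nonneg (norm_nonneg _) _), mul_div]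
    gcongr
    calc |bracketPow n s x - bracketPow n s z| ≤ 1 := by rw [abs_le]; constructor <;> linarith
      _ = (min 1 (ε ^ 2))⁻¹ * min 1 (ε ^ 2) := by field_simp
      _ ≤ _ := by gcongr

theorem setIntegral_second_difference_bracketPow {n : ℕ} (hn : 0 < n) {s ε : ℝ} (hs0 : 0 < s)
    (hs1 : s < 1) (hε : 0 < ε) (x : Euc n) :
    ∫ y in {y : Euc n | ε < ‖y‖},
      (2 * bracketPow n s x - bracketPow n s (x + y) - bracketPow n s (x - y)) /
        ‖y‖ ^ ((n : ℝ) + 2 * s) =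
    2 * ∫ z in {z : Euc n | ε < ‖z - x‖},
      (bracketPow n s x - bracketPow n s z) / ‖z - x‖ ^ ((n : ℝ) + 2 * s) := by
  set g : Euc n → ℝ := fun z =>
    (bracketPow n s x - bracketPow n s z) / ‖z - x‖ ^ ((n : ℝ) + 2 * s) with hg
  have hgi : IntegrableOn g {z | ε < ‖z - x‖} :=
    integrableOn_difference_bracketPow hn hs0 hs1 hε x
  have padd := measurePreserving_add_left (volume : Measure (Euc n)) x
  have psub := Measure.measurePreserving_sub_left (volume : Measure (Euc n)) x
  have eadd : MeasurableEmbedding (fun y : Euc n => x + y) :=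
    (MeasurableEquiv.addLeft x).measurableEmbedding
  have esub : MeasurableEmbedding (fun y : Euc n => x - y) :=
    (MeasurableEquiv.subLeft x).measurableEmbedding
  have sadd : (fun y : Euc n => x + y) ⁻¹' {z | ε < ‖z - x‖} = {y | ε < ‖y‖} := by
    ext y; simp
  have ssub : (fun y : Euc n => x - y) ⁻¹' {z | ε < ‖z - x‖} = {y | ε < ‖y‖} := by
    ext y; simp
  have iadd := padd.setIntegral_preimage_emb eadd g {z | ε < ‖z - x‖}
  have isub := psub.setIntegral_preimage_emb esub g {z | ε < ‖z - x‖}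
  have hadd := (padd.integrableOn_comp_preimage eadd).2 hgi
  have hsub := (psub.integrableOn_comp_preimage esub).2 hgi
  rw [sadd] at iadd hadd
  rw [ssub] at isub hsub
  change _ = 2 * ∫ z in {z : Euc n | ε < ‖z - x‖}, g z
  rw [two_mul (integral _ _)]
  nth_rewrite 1 [← iadd]
  rw [← isub]
  refine Eq.trans ?_ (integral_add hadd hsub)
  congr 1
  ext y
  simp only [hg, add_sub_cancel_left, sub_sub_cancel_left, norm_neg]
  ring

theorem abs_det_smul_reflection {n : ℕ} (c : ℝ) (K : Submodule ℝ (Euc n)) :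
    |(c • (K.reflection : Euc n →L[ℝ] Euc n)).det| = |c| ^ n := by
  have h : |LinearMap.det (K.reflection : Euc n →L[ℝ] Euc n).toLinearMap| = 1 := by
    have := K.det_reflection
    calc _ = |LinearMap.det K.reflection.toLinearMap| := rfl
      _ = 1 := by rw [this]; simp
  rw [ContinuousLinearMap.det, ContinuousLinearMap.toLinearMap_smul, LinearMap.det_smul, abs_mul, h,
    finrank_euclideanSpace_fin, abs_pow, mul_one]

theorem measurableSet_far_and_outer {n : ℕ} (ε : ℝ) (x : Euc n) :
    MeasurableSet {z : Euc n | ε < ‖z - x‖ ∧ ‖x‖ ≤ ‖z‖} := by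
  have h1 : MeasurableSet {z : Euc n | ε < ‖z - x‖} := measurableSet_lt (by fun_prop) (by fun_prop)
  have h2 : MeasurableSet {z : Euc n | ‖x‖ ≤ ‖z‖} := measurableSet_le (by fun_prop) (by fun_prop)
  exact h1.inter h2

theorem measurableSet_far_and_inner {n : ℕ} (ε : ℝ) (x : Euc n) :
    MeasurableSet {z : Euc n | ε < ‖z - x‖ ∧ ‖z‖ ≤ ‖x‖} := by
  have h1 : MeasurableSet {z : Euc n | ε < ‖z - x‖} := measurableSet_lt (by fun_prop) (by fun_prop)
  have h2 : MeasurableSet {z : Euc n | ‖z‖ ≤ ‖x‖} := measurableSet_le (by fun_prop) (by fun_prop)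
  exact h1.inter h2

theorem difference_quotient_nonneg {n : ℕ} {s : ℝ} (hs0 : 0 < s) {x z : Euc n}
    (hz : ‖x‖ ≤ ‖z‖) (q : ℝ) : 0 ≤ (bracketPow n s x - bracketPow n s z) / ‖z - x‖ ^ q :=
  div_nonneg (sub_nonneg.2 (bracketPow_anti n hs0 hz)) (Real.rpow_nonneg (norm_nonneg _) _)

theorem integrableOn_weighted_outer {n : ℕ} (hn0 : 0 < n) {s ε : ℝ} (hs0 : 0 < s) (hs1 : s < 1)
    (hn : 4 * s < (n : ℝ)) (hε : 0 < ε) (x : Euc n) :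
    IntegrableOn (fun z : Euc n => (‖x‖ / ‖z‖) ^ ((n : ℝ) - 4 * s) *
      ((bracketPow n s x - bracketPow n s z) / ‖z - x‖ ^ ((n : ℝ) + 2 * s)))
      {z | ε < ‖z - x‖ ∧ ‖x‖ ≤ ‖z‖} := by
  have hbm := (continuous_bracketPow n s).measurable
  refine ((integrableOn_difference_bracketPow hn0 hs0 hs1 hε x).mono_set fun z hz => hz.1).mono'
    (Measurable.aestronglyMeasurable (by fun_prop))
    ((ae_restrict_iff' (measurableSet_far_and_outer ε x)).2
      (Filter.Eventually.of_forall fun z hz => ?_))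
  have hz : ε < ‖z - x‖ ∧ ‖x‖ ≤ ‖z‖ := hz
  have hF := difference_quotient_nonneg hs0 hz.2 ((n : ℝ) + 2 * s)
  rw [Real.norm_eq_abs, abs_of_nonneg (mul_nonneg (Real.rpow_nonneg (by positivity) _) hF)]
  exact mul_le_of_le_one_left hF (Real.rpow_le_one (by positivity)
    (div_le_one_of_le₀ hz.2 (norm_nonneg _)) (by linarith))

theorem inversion_weight_identity {n : ℕ} {s R r d : ℝ} (hR : 0 < R) (hr : 0 < r) (hd : 0 < d)
    (a : ℝ) :
    ((R / r) ^ 2) ^ n * ((R / (R ^ 2 / r)) ^ ((n : ℝ) - 4 * s) *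
      (a / (R / r * d) ^ ((n : ℝ) + 2 * s))) =
    (R / r) ^ (2 * s) * a / d ^ ((n : ℝ) + 2 * s) := by
  have ht : 0 < R / r := by positivity
  have e : R / (R ^ 2 / r) = (R / r)⁻¹ := by field_simp
  rw [e, Real.mul_rpow ht.le hd.le, Real.inv_rpow ht.le, ← Real.rpow_neg ht.le, ← pow_mul,
    ← Real.rpow_natCast]
  have : (R / r) ^ (2 * s) = (R / r) ^ ((2 * n : ℕ) : ℝ) * (R / r) ^ (-((n : ℝ) - 4 * s)) /
      (R / r) ^ ((n : ℝ) + 2 * s) := by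
    rw [← Real.rpow_add ht, ← Real.rpow_sub ht]
    congr 1
    push_cast; ring
  rw [this]
  field_simp

/-- Inversion in the sphere through `x` centred at `0` bounds the inner part of the truncated
singular integral by a weighted version of the outer part. -/
theorem neg_setIntegral_inner_le {n : ℕ} (hn0 : 0 < n) {s ε : ℝ} (hs0 : 0 < s) (hs1 : s < 1)
    (hn : 4 * s < (n : ℝ)) (hε : 0 < ε) (x : Euc n) :
    -∫ z in {z : Euc n | ε < ‖z - x‖ ∧ ‖z‖ ≤ ‖x‖},
      (bracketPow n s x - bracketPow n s z) / ‖z - x‖ ^ ((n : ℝ) + 2 * s) ≤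
    ∫ z in {z : Euc n | ε < ‖z - x‖ ∧ ‖x‖ ≤ ‖z‖}, (‖x‖ / ‖z‖) ^ ((n : ℝ) - 4 * s) *
      ((bracketPow n s x - bracketPow n s z) / ‖z - x‖ ^ ((n : ℝ) + 2 * s)) := by
  have : Nonempty (Fin n) := ⟨⟨0, hn0⟩⟩
  set q : ℝ := (n : ℝ) + 2 * s with hq
  set F : Euc n → ℝ := fun z => (bracketPow n s x - bracketPow n s z) / ‖z - x‖ ^ q with hF
  set g : Euc n → ℝ := fun z => (‖x‖ / ‖z‖) ^ ((n : ℝ) - 4 * s) * F z with hg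
  have hFi : IntegrableOn F {z | ε < ‖z - x‖} :=
    integrableOn_difference_bracketPow hn0 hs0 hs1 hε x
  have hFout : ∀ z : Euc n, ‖x‖ ≤ ‖z‖ → 0 ≤ F z := fun z hz =>
    difference_quotient_nonneg hs0 hz q
  have hgout : ∀ z : Euc n, ‖x‖ ≤ ‖z‖ → 0 ≤ g z := fun z hz =>
    mul_nonneg (Real.rpow_nonneg (by positivity) _) (hFout z hz)
  have hOm : MeasurableSet {z : Euc n | ε < ‖z - x‖ ∧ ‖x‖ ≤ ‖z‖} :=
    measurableSet_far_and_outer ε x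
  have hgi : IntegrableOn g {z | ε < ‖z - x‖ ∧ ‖x‖ ≤ ‖z‖} :=
    integrableOn_weighted_outer hn0 hs0 hs1 hn hε x
  rcases eq_or_ne x 0 with hx | hx
  · have : {z : Euc n | ε < ‖z - x‖ ∧ ‖z‖ ≤ ‖x‖} = ∅ := by
      ext z
      simp only [hx, sub_zero, norm_zero, Set.mem_ofPred_eq, Set.mem_empty_iff_false, iff_false,
        not_and, not_le]
      exact fun h => hε.trans h
    rw [this]
    simp only [Measure.restrict_empty, integral_zero_measure, neg_zero]
    exact setIntegral_nonneg hOm fun z hz => hgout z hz.2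
  have hR : 0 < ‖x‖ := norm_pos_iff.2 hx
  set I : Set (Euc n) := {z | ε < ‖z - x‖ ∧ ‖z‖ ≤ ‖x‖} \ {0} with hI
  have hIm : MeasurableSet I :=
    (measurableSet_far_and_inner ε x).diff (measurableSet_singleton 0)
  have hI0 : ∀ z ∈ I, z ≠ 0 := fun z hz => hz.2
  set φ : Euc n → Euc n := EuclideanGeometry.inversion 0 ‖x‖ with hφ
  have hφx : φ x = x := EuclideanGeometry.inversion_of_mem_sphere (by simp)
  have hnφ : ∀ z, ‖φ z‖ = ‖x‖ ^ 2 / ‖z‖ := fun z => by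
    simpa using EuclideanGeometry.dist_inversion_center (0 : Euc n) z ‖x‖
  have hdφ : ∀ z, z ≠ 0 → ‖φ z - x‖ = ‖x‖ / ‖z‖ * ‖z - x‖ := fun z hz => by
    have := EuclideanGeometry.dist_inversion_inversion hz hx ‖x‖
    rw [← hφ, hφx, dist_zero_right, dist_zero_right, dist_eq_norm, dist_eq_norm] at this
    rw [this]
    field_simp
  have hder : ∀ z ∈ I, HasFDerivWithinAt φ
      ((‖x‖ / ‖z‖) ^ 2 • ((ℝ ∙ z)ᗮ.reflection : Euc n →L[ℝ] Euc n)) I z := fun z hz => by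
    have := (EuclideanGeometry.hasFDerivAt_inversion (R := ‖x‖) (hI0 z hz)).hasFDerivWithinAt
      (s := I)
    simpa using this
  have hinj : Set.InjOn φ I := (EuclideanGeometry.inversion_injective 0 hR.ne').injOn
  have hsub : φ '' I ⊆ {z | ε < ‖z - x‖ ∧ ‖x‖ ≤ ‖z‖} := by
    rintro _ ⟨z, hz, rfl⟩
    have hz0 : 0 < ‖z‖ := norm_pos_iff.2 (hI0 z hz)
    have hzR : ‖z‖ ≤ ‖x‖ := hz.1.2
    refine ⟨?_, ?_⟩
    · rw [hdφ z (hI0 z hz)]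
      have h1 : 1 ≤ ‖x‖ / ‖z‖ := (one_le_div hz0).2 hzR
      have h2 : ε < ‖z - x‖ := hz.1.1
      nlinarith
    · rw [hnφ, le_div_iff₀ hz0]
      nlinarith
  have hpt : ∀ z ∈ I, |((‖x‖ / ‖z‖) ^ 2 • ((ℝ ∙ z)ᗮ.reflection : Euc n →L[ℝ] Euc n)).det| •
      g (φ z) = (‖x‖ / ‖z‖) ^ (2 * s) * (bracketPow n s x - bracketPow n s (φ z)) /
        ‖z - x‖ ^ q := fun z hz => by
    have hz0 : 0 < ‖z‖ := norm_pos_iff.2 (hI0 z hz)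
    rw [abs_det_smul_reflection, abs_of_nonneg (by positivity), smul_eq_mul]
    simp only [hg, hF]
    rw [hnφ, hdφ z (hI0 z hz)]
    exact inversion_weight_identity hR hz0 (hε.trans hz.1.1) _
  have hgI : IntegrableOn g (φ '' I) := hgi.mono_set hsub
  have hgI' := (integrableOn_image_iff_integrableOn_abs_det_fderiv_smul volume hIm hder hinj g).1 hgI
  calc -∫ z in {z : Euc n | ε < ‖z - x‖ ∧ ‖z‖ ≤ ‖x‖}, F z
      = ∫ z in I, -F z := by
        rw [integral_neg]
        congr 1
        refine setIntegral_congr_set ?_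
        exact (sdiff_null_ae_eq_self (measure_singleton 0)).symm
    _ ≤ ∫ z in I, |((‖x‖ / ‖z‖) ^ 2 • ((ℝ ∙ z)ᗮ.reflection : Euc n →L[ℝ] Euc n)).det| •
          g (φ z) := by
        refine setIntegral_mono_on (hFi.mono_set fun z hz => hz.1.1).neg hgI' hIm fun z hz => ?_
        have hz0 : 0 < ‖z‖ := norm_pos_iff.2 (hI0 z hz)
        rw [hpt z hz]
        simp only [hF]
        rw [← neg_div, neg_sub]
        gcongr
        have := bracket_sub_le_inversion hs0 hs1 hz0 hz.1.2
        rw [← hnφ] at this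
        exact this
    _ = ∫ z in φ '' I, g z :=
        (integral_image_eq_integral_abs_det_fderiv_smul volume hIm hder hinj g).symm
    _ ≤ ∫ z in {z : Euc n | ε < ‖z - x‖ ∧ ‖x‖ ≤ ‖z‖}, g z :=
        setIntegral_mono_set hgi ((ae_restrict_iff' hOm).2
          (Filter.Eventually.of_forall fun z hz => hgout z hz.2)) hsub.eventuallyLE

/-- A lower bound, uniform in the truncation, for the singular integral defining
`(-Δ)^s (1 + |·|²)^{-s}`. -/
theorem le_setIntegral_difference_bracketPow {n : ℕ} (hn0 : 0 < n) {s ε : ℝ} (hs0 : 0 < s)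
    (hs1 : s < 1) (hn : 4 * s < (n : ℝ)) (hε : 0 < ε) (hε1 : ε < 1) (x : Euc n) :
    (1 - (1 / 2 : ℝ) ^ ((n : ℝ) - 4 * s)) * (1 - (4 : ℝ) ^ (-s)) / 5 ^ ((n : ℝ) + 2 * s) *
      volume.real (Metric.ball (0 : Euc n) 1) * (1 + ‖x‖ ^ 2) ^ (-(2 * s)) ≤
    ∫ z in {z : Euc n | ε < ‖z - x‖},
      (bracketPow n s x - bracketPow n s z) / ‖z - x‖ ^ ((n : ℝ) + 2 * s) := by
  set q : ℝ := (n : ℝ) + 2 * s with hq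
  set F : Euc n → ℝ := fun z => (bracketPow n s x - bracketPow n s z) / ‖z - x‖ ^ q with hF
  set g : Euc n → ℝ := fun z => (‖x‖ / ‖z‖) ^ ((n : ℝ) - 4 * s) * F z with hg
  set O : Set (Euc n) := {z | ε < ‖z - x‖ ∧ ‖x‖ ≤ ‖z‖} with hO
  set I : Set (Euc n) := {z | ε < ‖z - x‖ ∧ ‖z‖ ≤ ‖x‖} with hI
  have hOm : MeasurableSet O := measurableSet_far_and_outer ε x
  have hIm : MeasurableSet I := measurableSet_far_and_inner ε x
  have hFi : IntegrableOn F {z | ε < ‖z - x‖} :=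
    integrableOn_difference_bracketPow hn0 hs0 hs1 hε x
  have hFO : IntegrableOn F O := hFi.mono_set fun z hz => hz.1
  have hFI : IntegrableOn F I := hFi.mono_set fun z hz => hz.1
  have hgO : IntegrableOn g O := integrableOn_weighted_outer hn0 hs0 hs1 hn hε x
  have hsplit : ∫ z in {z : Euc n | ε < ‖z - x‖}, F z = (∫ z in O, F z) + ∫ z in I, F z := by
    have hset : {z : Euc n | ε < ‖z - x‖} = O ∪ (I \ O) := by
      ext z
      constructor
      · intro hz
        rcases le_total ‖x‖ ‖z‖ with h | h
        · exact Or.inl ⟨hz, h⟩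
        · by_cases hzO : z ∈ O
          · exact Or.inl hzO
          · exact Or.inr ⟨⟨hz, h⟩, hzO⟩
      · rintro (hz | hz)
        · exact hz.1
        · exact hz.1.1
    rw [hset, setIntegral_union disjoint_sdiff_self_right (hIm.diff hOm) hFO
      (hFI.mono_set Set.sdiff_subset)]
    congr 1
    refine (setIntegral_eq_of_subset_of_forall_sdiff_eq_zero hIm Set.sdiff_subset fun z hz => ?_).symm
    have hzO : z ∈ O := by
      by_contra h
      exact hz.2 ⟨hz.1, h⟩
    have hxz : ‖z‖ = ‖x‖ := le_antisymm hz.1.2 hzO.2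
    simp only [hF, bracketPow, hxz, sub_self, zero_div]
  have hinner : -∫ z in I, F z ≤ ∫ z in O, g z :=
    neg_setIntegral_inner_le hn0 hs0 hs1 hn hε x
  set m : ℝ := Real.sqrt (1 + ‖x‖ ^ 2) with hm
  have hm2 : m ^ 2 = 1 + ‖x‖ ^ 2 := Real.sq_sqrt (by positivity)
  have hm0 : 0 < m := Real.sqrt_pos.2 (by positivity)
  have hm1 : 1 ≤ m := by nlinarith [sq_nonneg ‖x‖]
  have hxm : ‖x‖ ≤ m := abs_le_of_sq_le_sq' (by linarith) hm0.le |>.2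
  set e : Euc n := (3 * m) • EuclideanSpace.single ⟨0, hn0⟩ (1 : ℝ) with he
  have hen : ‖e‖ = 3 * m := by
    rw [he, norm_smul, PiLp.norm_single, norm_one, mul_one, Real.norm_eq_abs,
      abs_of_pos (by positivity)]
  have hT : ∀ z ∈ Metric.ball e m, 2 * m ≤ ‖z‖ ∧ ‖z‖ ≤ 4 * m ∧ m ≤ ‖z - x‖ ∧
      ‖z - x‖ ≤ 5 * m := fun z hz => by
    rw [mem_ball_iff_norm] at hz
    have h1 := norm_sub_norm_le e z
    have h2 := norm_sub_norm_le z e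
    have h3 := norm_sub_norm_le z x
    have h4 := norm_sub_le z x
    rw [norm_sub_rev] at h1
    refine ⟨?_, ?_, ?_, ?_⟩ <;> linarith
  have hTO : Metric.ball e m ⊆ O := fun z hz => by
    obtain ⟨h1, -, h3, -⟩ := hT z hz
    exact ⟨by linarith, by linarith⟩
  have hFgO : ∀ z ∈ O, 0 ≤ F z - g z := fun z hz => by
    have h0 : 0 ≤ F z := difference_quotient_nonneg hs0 hz.2 q
    have : (‖x‖ / ‖z‖) ^ ((n : ℝ) - 4 * s) ≤ 1 := Real.rpow_le_one (by positivity)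
      (div_le_one_of_le₀ hz.2 (norm_nonneg _)) (by linarith)
    have : g z ≤ F z := mul_le_of_le_one_left h0 this
    linarith
  have hhalf : (1 / 2 : ℝ) ^ ((n : ℝ) - 4 * s) ≤ 1 :=
    Real.rpow_le_one (by norm_num) (by norm_num) (by linarith)
  have hfour : (4 : ℝ) ^ (-s) ≤ 1 :=
    Real.rpow_le_one_of_one_le_of_nonpos (by norm_num) (by linarith)
  have hlow : ∀ z ∈ Metric.ball e m, (1 - (1 / 2 : ℝ) ^ ((n : ℝ) - 4 * s)) *
      ((1 - (4 : ℝ) ^ (-s)) * (m ^ 2) ^ (-s) / (5 * m) ^ q) ≤ F z - g z := fun z hz => by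
    obtain ⟨h1, h2, h3, h4⟩ := hT z hz
    have hz0 : 0 < ‖z‖ := by linarith
    have hw : (‖x‖ / ‖z‖) ^ ((n : ℝ) - 4 * s) ≤ (1 / 2 : ℝ) ^ ((n : ℝ) - 4 * s) := by
      refine Real.rpow_le_rpow (by positivity) ?_ (by linarith)
      rw [div_le_div_iff₀ hz0 two_pos]
      linarith
    have hu : (1 - (4 : ℝ) ^ (-s)) * (m ^ 2) ^ (-s) ≤ bracketPow n s x - bracketPow n s z := by
      have : bracketPow n s z ≤ (4 * m ^ 2) ^ (-s) :=
        Real.rpow_le_rpow_of_nonpos (by positivity) (by nlinarith) (by linarith)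
      rw [Real.mul_rpow (by norm_num) (by positivity)] at this
      have hx : bracketPow n s x = (m ^ 2) ^ (-s) := by rw [hm2]; rfl
      rw [hx]
      linarith
    have hd : 0 < ‖z - x‖ := by linarith
    have hFz : (1 - (4 : ℝ) ^ (-s)) * (m ^ 2) ^ (-s) / (5 * m) ^ q ≤ F z := by
      refine div_le_div₀ (le_trans ?_ hu) hu (by positivity)
        (Real.rpow_le_rpow hd.le h4 (by positivity))
      exact mul_nonneg (by linarith) (by positivity)
    have : F z - g z = (1 - (‖x‖ / ‖z‖) ^ ((n : ℝ) - 4 * s)) * F z := by simp only [hg]; ring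
    rw [this]
    refine mul_le_mul (by linarith) hFz ?_ (by linarith)
    exact div_nonneg (mul_nonneg (by linarith) (by positivity)) (by positivity)
  have hvol : volume.real (Metric.ball e m) = m ^ n * volume.real (Metric.ball (0 : Euc n) 1) := by
    rw [Measure.real, Measure.addHaar_ball_of_pos _ _ hm0, ENNReal.toReal_mul,
      ENNReal.toReal_ofReal (by positivity), finrank_euclideanSpace_fin]
    rfl
  have hscale : (m ^ 2) ^ (-s) / (5 * m) ^ q * m ^ n = (m ^ 2) ^ (-(2 * s)) / 5 ^ q := by
    rw [Real.mul_rpow (by norm_num) hm0.le, ← Real.rpow_natCast m 2, ← Real.rpow_natCast m n,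
      ← Real.rpow_mul hm0.le, ← Real.rpow_mul hm0.le]
    have : m ^ (((2 : ℕ) : ℝ) * -(2 * s)) = m ^ (((2 : ℕ) : ℝ) * -s) * m ^ (n : ℝ) / m ^ q := by
      rw [← Real.rpow_add hm0, ← Real.rpow_sub hm0]
      congr 1
      push_cast; rw [hq]; ring
    rw [this]
    field_simp
  calc _ = (1 - (1 / 2 : ℝ) ^ ((n : ℝ) - 4 * s)) *
        ((1 - (4 : ℝ) ^ (-s)) * (m ^ 2) ^ (-s) / (5 * m) ^ q) * volume.real (Metric.ball e m) := by
        rw [hvol, ← hm2]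
        linear_combination (-(1 - (1 / 2 : ℝ) ^ ((n : ℝ) - 4 * s)) * (1 - (4 : ℝ) ^ (-s)) *
          volume.real (Metric.ball (0 : Euc n) 1)) * hscale
    _ ≤ ∫ z in Metric.ball e m, F z - g z :=
        setIntegral_ge_of_const_le_real Metric.isOpen_ball.measurableSet
          measure_ball_lt_top.ne hlow ((hFO.sub hgO).mono_set hTO)
    _ ≤ ∫ z in O, F z - g z :=
        setIntegral_mono_set (hFO.sub hgO) ((ae_restrict_iff' hOm).2
          (Filter.Eventually.of_forall hFgO)) hTO.eventuallyLE
    _ = (∫ z in O, F z) - ∫ z in O, g z := integral_sub hFO hgO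
    _ ≤ _ := by rw [hsplit]; linarith

theorem fracC_pos (n : ℕ) {s : ℝ} (hs0 : 0 < s) (hs1 : s < 1) : 0 < fracC n s := by
  have h1 : 0 < Real.Gamma (((n : ℝ) + 2 * s) / 2) := Real.Gamma_pos_of_pos (by positivity)
  have h2 : Real.Gamma (-s) ≠ 0 := by
    refine Real.Gamma_ne_zero fun k hk => ?_
    have hk' : s = (k : ℝ) := by linarith
    rw [hk'] at hs0 hs1
    norm_cast at hs0 hs1
    omega
  unfold fracC
  have := abs_pos.2 h2
  positivity

/-- For `s ∈ (0,1)` and `n > 4s` there is `α_{n,s} > 0` with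
`(-Δ)^s (1+|·|²)^{-s} (x) ≥ α_{n,s} (1+|x|²)^{-2s}` for all `x ∈ ℝⁿ`. -/
theorem stmt_17 (n : ℕ) (s : ℝ) (hs0 : 0 < s) (hs1 : s < 1) (hn : 4 * s < (n : ℝ)) :
    ∃ α : ℝ, 0 < α ∧ ∀ x : Euc n,
      α * (1 + ‖x‖ ^ 2) ^ (-(2 * s)) ≤
        fracLap n s (fun y => (1 + ‖y‖ ^ 2) ^ (-s)) x := by
  have hn0 : 0 < n := by
    have : (0 : ℝ) < n := by linarith
    exact_mod_cast this
  have : Nonempty (Fin n) := ⟨⟨0, hn0⟩⟩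
  set c : ℝ := (1 - (1 / 2 : ℝ) ^ ((n : ℝ) - 4 * s)) * (1 - (4 : ℝ) ^ (-s)) /
    5 ^ ((n : ℝ) + 2 * s) * volume.real (Metric.ball (0 : Euc n) 1) with hc
  have hhalf : (1 / 2 : ℝ) ^ ((n : ℝ) - 4 * s) < 1 :=
    Real.rpow_lt_one (by norm_num) (by norm_num) (by linarith)
  have hfour : (4 : ℝ) ^ (-s) < 1 :=
    Real.rpow_lt_one_of_one_lt_of_neg (by norm_num) (by linarith)
  have hball : 0 < volume.real (Metric.ball (0 : Euc n) 1) :=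
    ENNReal.toReal_pos (Metric.measure_ball_pos volume 0 one_pos).ne' measure_ball_lt_top.ne
  have hc0 : 0 < c :=
    mul_pos (div_pos (mul_pos (by linarith) (by linarith)) (by positivity)) hball
  have hC := fracC_pos n hs0 hs1
  refine ⟨fracC n s * c, mul_pos hC hc0, fun x => ?_⟩
  set S : Euc n → ℝ := fun y =>
    (2 * bracketPow n s x - bracketPow n s (x + y) - bracketPow n s (x - y)) /
      ‖y‖ ^ ((n : ℝ) + 2 * s) with hS
  have hSi : Integrable S := integrable_second_difference_bracketPow hn0 hs0 hs1 x
  set A : ℕ → Set (Euc n) := fun k => {y | 1 / ((k : ℝ) + 2) < ‖y‖} with hA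
  have hAm : ∀ k, MeasurableSet (A k) := fun k => measurableSet_lt (by fun_prop) (by fun_prop)
  have hAmono : Monotone A := fun i j hij y hy => by
    refine lt_of_le_of_lt ?_ (show 1 / ((i : ℝ) + 2) < ‖y‖ from hy)
    gcongr
  have hAU : (⋃ k, A k) = {0}ᶜ := by
    ext y
    simp only [Set.mem_iUnion, Set.mem_compl_iff, Set.mem_singleton_iff]
    constructor
    · rintro ⟨k, hk⟩ rfl
      have hk : 1 / ((k : ℝ) + 2) < ‖(0 : Euc n)‖ := hk
      rw [norm_zero] at hk
      exact absurd hk (not_lt.2 (by positivity))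
    · intro hy
      obtain ⟨k, hk⟩ := exists_nat_one_div_lt (norm_pos_iff.2 hy)
      refine ⟨k, lt_of_le_of_lt ?_ hk⟩
      gcongr
      norm_num
  have hlim := tendsto_setIntegral_of_monotone hAm hAmono hSi.integrableOn
  rw [hAU, restrict_compl_singleton] at hlim
  have hge : 2 * (c * (1 + ‖x‖ ^ 2) ^ (-(2 * s))) ≤ ∫ y, S y := by
    refine ge_of_tendsto hlim (Filter.Eventually.of_forall fun k => ?_)
    have hk0 : (0 : ℝ) < 1 / ((k : ℝ) + 2) := by positivity
    have hk1 : 1 / ((k : ℝ) + 2) < 1 := by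
      rw [div_lt_one (by positivity)]
      have : (0 : ℝ) ≤ k := Nat.cast_nonneg k
      linarith
    have h1 := setIntegral_second_difference_bracketPow hn0 hs0 hs1 hk0 x
    have h2 := le_setIntegral_difference_bracketPow hn0 hs0 hs1 hn hk0 hk1 x
    calc _ ≤ _ := mul_le_mul_of_nonneg_left h2 two_pos.le
      _ = _ := h1.symm
  change _ ≤ fracC n s / 2 * ∫ y, S y
  calc _ = fracC n s / 2 * (2 * (c * (1 + ‖x‖ ^ 2) ^ (-(2 * s)))) := by ring
    _ ≤ _ := by gcongr
end
end
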